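/- arXiv:1911.07708 — 2 statements merged into one kernel-verified Lean document; each statement's English description precedes it below -/
import Mathlib

section
/- Let (R,m,k) be a commutative Noetherian local ring, let R̂ denote its m-adic completion, and let M be a finitely generated R-module. Then M is a pd-test module over R if and only if the completion R̂ ⊗_R M is a pd-test module over R̂. -/
open CategoryTheory IsLocalRing

universe u

/-- `Tor_i^R(M, N)` is the zero module. -/
def TorIsZero (R : Type u) [CommRing R] (M N : Type u) [AddCommGroup M] [Module R M]
    [AddCommGroup N] [Module R N] (i : ℕ) : Prop :=
  Limits.IsZero (((Tor (ModuleCat.{u} R) i).obj (ModuleCat.of R M)).obj (ModuleCat.of R N))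

/-- `N` has finite projective dimension over `R`: it admits a bounded projective resolution. -/
def HasFiniteProjDim (R : Type u) [CommRing R] (N : Type u) [AddCommGroup N] [Module R N] :
    Prop :=
  ∃ (n : ℕ) (P : ProjectiveResolution (ModuleCat.of R N)),
    ∀ i, n < i → Limits.IsZero (P.complex.X i)

/-- `M` is a pd-test module over `R`: for every finitely generated `R`-module `N`, if
`Tor_i^R(M, N) = 0` for all sufficiently large `i`, then `N` has finite projective
dimension over `R`. -/
def IsPdTest (R : Type u) [CommRing R] (M : Type u) [AddCommGroup M] [Module R M] : Prop :=
  ∀ (N : Type u) [AddCommGroup N] [Module R N], Module.Finite R N →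
    (∃ n : ℕ, ∀ i, n < i → TorIsZero R M N i) → HasFiniteProjDim R N

open scoped TensorProduct

open Function

/-- The first syzygy of `T` with respect to the tautological free cover `T →₀ R → T`. -/
noncomputable abbrev tautSyzygy (R : Type u) [CommRing R] (T : Type u) [AddCommGroup T]
    [Module R T] : Submodule R (T →₀ R) :=
  LinearMap.ker (Finsupp.linearCombination R (id : T → T))

/-- An elementwise form of `Tor_{n+1}^R(T, C) = 0`, by dimension shifting in `T`. -/
def TorSuccVanishes (R : Type u) [CommRing R] (C : Type u) [AddCommGroup C] [Module R C] :
    ℕ → ∀ (T : Type u) [AddCommGroup T] [Module R T], Prop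
  | 0, T, _, _ => Injective ((tautSyzygy R T).subtype.rTensor C)
  | n + 1, T, _, _ => TorSuccVanishes R C n (tautSyzygy R T)

section TorSuccVanishes

variable {R : Type u} [CommRing R]
variable {T B Y C : Type u} [AddCommGroup T] [Module R T] [AddCommGroup B] [Module R B]
  [AddCommGroup Y] [Module R Y] [AddCommGroup C] [Module R C]

lemma exact_tautSyzygy : Exact (tautSyzygy R T).subtype
    (Finsupp.linearCombination R (id : T → T)) :=
  LinearMap.exact_subtype_ker_map _

lemma surjective_linearCombination_id :
    Surjective (Finsupp.linearCombination R (id : T → T)) :=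
  Finsupp.linearCombination_id_surjective R T

/-- Symmetry of `Tor_1`, phrased with flat presentations of both modules. -/
lemma rTensor_injective_iff_lTensor_injective {K G : Type u} [AddCommGroup K] [Module R K]
    [AddCommGroup G] [Module R G] [Module.Flat R G] [Module.Flat R Y]
    {i : K →ₗ[R] G} {p : G →ₗ[R] T} {f : B →ₗ[R] Y} {g : Y →ₗ[R] C}
    (hi : Injective i) (hip : Exact i p) (hp : Surjective p)
    (hf : Injective f) (hfg : Exact f g) (hg : Surjective g) :
    Injective (i.rTensor C) ↔ Injective (f.lTensor T) := by
  constructor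
  · intro h
    exact lTensor_injective_of_exact_of_exact_of_rTensor_injective hip hp hfg hg h
      (Module.Flat.lTensor_preserves_injective_linearMap f hf)
  · intro h
    rw [← LinearMap.lTensor_inj_iff_rTensor_inj]
    refine lTensor_injective_of_exact_of_exact_of_rTensor_injective hfg hg hip hp ?_
      (Module.Flat.lTensor_preserves_injective_linearMap i hi)
    rwa [← LinearMap.lTensor_inj_iff_rTensor_inj]

lemma torSuccVanishes_zero_iff [Module.Flat R Y] {f : B →ₗ[R] Y} {g : Y →ₗ[R] C}
    (hf : Injective f) (hfg : Exact f g) (hg : Surjective g) :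
    TorSuccVanishes R C 0 T ↔ Injective (f.lTensor T) := by
  have h := rTensor_injective_iff_lTensor_injective (f := f) (g := g) (K := tautSyzygy R T)
    (G := T →₀ R) (i := (tautSyzygy R T).subtype)
    (p := Finsupp.linearCombination R (id : T → T)) (Submodule.injective_subtype _)
  exact h exact_tautSyzygy surjective_linearCombination_id hf hfg hg

lemma torSuccVanishes_succ_iff [Module.Flat R Y] {f : B →ₗ[R] Y} {g : Y →ₗ[R] C}
    (hf : Injective f) (hfg : Exact f g) (hg : Surjective g) (n : ℕ) :
    TorSuccVanishes R C (n + 1) T ↔ TorSuccVanishes R B n T := by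
  induction n generalizing T with
  | zero =>
    change TorSuccVanishes R C 0 (tautSyzygy R T) ↔
      Injective ((tautSyzygy R T).subtype.rTensor B)
    rw [torSuccVanishes_zero_iff hf hfg hg]
    have h1 : Injective (f.lTensor (T →₀ R)) :=
      Module.Flat.lTensor_preserves_injective_linearMap f hf
    have h2 : Injective ((tautSyzygy R T).subtype.rTensor Y) :=
      Module.Flat.rTensor_preserves_injective_linearMap _ (Submodule.injective_subtype _)
    have e : f.lTensor (T →₀ R) ∘ₗ (tautSyzygy R T).subtype.rTensor B =
        (tautSyzygy R T).subtype.rTensor Y ∘ₗ f.lTensor (tautSyzygy R T) := by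
      rw [LinearMap.lTensor_comp_rTensor, LinearMap.rTensor_comp_lTensor]
    rw [← h2.of_comp_iff, ← LinearMap.coe_comp, ← e, LinearMap.coe_comp, h1.of_comp_iff]
  | succ n ih => exact ih

lemma TorSuccVanishes.congr_left {T' : Type u} [AddCommGroup T'] [Module R T'] (e : T ≃ₗ[R] T')
    (n : ℕ) : TorSuccVanishes R C n T ↔ TorSuccVanishes R C n T' := by
  induction n generalizing C with
  | zero =>
    simp only [torSuccVanishes_zero_iff (B := tautSyzygy R C) (Submodule.injective_subtype _)
      exact_tautSyzygy surjective_linearCombination_id]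
    set f := (tautSyzygy R C).subtype
    have h : f.lTensor T' ∘ₗ (e.rTensor _).toLinearMap =
        (e.rTensor _).toLinearMap ∘ₗ f.lTensor T := by
      ext; simp
    have h1 := congrArg DFunLike.coe h
    simp only [LinearMap.coe_comp, LinearEquiv.coe_coe] at h1
    rw [← (e.rTensor _).injective.of_comp_iff (f.lTensor T), ← h1,
      Injective.of_comp_iff' _ (e.rTensor _).bijective]
  | succ n ih =>
    simp only [torSuccVanishes_succ_iff (B := tautSyzygy R C) (Submodule.injective_subtype _)
      exact_tautSyzygy surjective_linearCombination_id]
    exact ih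

/-- Exactness at `T ⊗ X₁` only involves the image of `X₁ → X₀`. -/
lemma exact_lTensor_iff_injective {X₂ X₁ X₀ : Type u} [AddCommGroup X₂] [Module R X₂]
    [AddCommGroup X₁] [Module R X₁] [AddCommGroup X₀] [Module R X₀]
    {f : X₂ →ₗ[R] X₁} {g : X₁ →ₗ[R] X₀} (h : Exact f g) :
    Exact (f.lTensor T) (g.lTensor T) ↔ Injective ((LinearMap.range g).subtype.lTensor T) := by
  have h1 : Exact (f.lTensor T) (g.rangeRestrict.lTensor T) :=
    lTensor_exact T (by
      intro x
      rw [← h x, Subtype.ext_iff]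
      rfl) g.surjective_rangeRestrict
  have hs : Surjective (g.rangeRestrict.lTensor T) :=
    LinearMap.lTensor_surjective T g.surjective_rangeRestrict
  have e : g.lTensor T = (LinearMap.range g).subtype.lTensor T ∘ₗ g.rangeRestrict.lTensor T := by
    rw [← LinearMap.lTensor_comp]; rfl
  rw [e]
  constructor
  · intro H
    rw [injective_iff_map_eq_zero]
    intro x hx
    obtain ⟨y, rfl⟩ := hs x
    exact (h1 y).2 ((H y).1 hx)
  · intro H x
    rw [← h1 x, LinearMap.comp_apply, map_eq_zero_iff _ H]

end TorSuccVanishes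

/-- A sequence of modules `⋯ → X 2 → X 1 → X 0` with vanishing composites. -/
structure ModSeq (A : Type u) [CommRing A] where
  /-- The terms. -/
  X : ℕ → Type u
  [acg : ∀ n, AddCommGroup (X n)]
  [mod : ∀ n, Module A (X n)]
  /-- The differentials. -/
  d : ∀ n, X (n + 1) →ₗ[A] X n
  d_d : ∀ n x, d n (d (n + 1) x) = 0

attribute [instance] ModSeq.acg ModSeq.mod

namespace ModSeq

variable {A : Type u} [CommRing A]

/-- Exactness in all sufficiently high degrees. -/
def EventuallyExact (S : ModSeq A) : Prop :=
  ∃ n₀, ∀ n, n₀ ≤ n → Exact (S.d (n + 1)) (S.d n)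

/-- The termwise tensor product with a module. -/
noncomputable def tensor (T : Type u) [AddCommGroup T] [Module A T] (S : ModSeq A) :
    ModSeq A where
  X n := T ⊗[A] S.X n
  d n := (S.d n).lTensor T
  d_d n x := by
    rw [← LinearMap.comp_apply, ← LinearMap.lTensor_comp,
      show S.d n ∘ₗ S.d (n + 1) = 0 from LinearMap.ext (S.d_d n), LinearMap.lTensor_zero,
      LinearMap.zero_apply]

variable (S : ModSeq A)

lemma exact_subtype_rangeRestrict {n : ℕ} (h : Exact (S.d (n + 1)) (S.d n)) :
    Exact (LinearMap.range (S.d (n + 1))).subtype (S.d n).rangeRestrict := by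
  intro x
  rw [Subtype.ext_iff]
  change S.d n x = 0 ↔ _
  rw [h x]
  simp

variable [∀ n, Module.Flat A (S.X n)] (T : Type u) [AddCommGroup T] [Module A T]

lemma torSuccVanishes_range_iff {s n m : ℕ} (hS : ∀ i, s ≤ i → Exact (S.d (i + 1)) (S.d i))
    (hm : m = s + n + 1) :
    TorSuccVanishes A (LinearMap.range (S.d s)) n T ↔
      Exact ((S.d (m + 1)).lTensor T) ((S.d m).lTensor T) := by
  induction n generalizing s with
  | zero =>
    subst hm
    rw [torSuccVanishes_zero_iff (Submodule.injective_subtype _)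
      (S.exact_subtype_rangeRestrict (hS s le_rfl)) (S.d s).surjective_rangeRestrict,
      ← exact_lTensor_iff_injective (hS (s + 1) (Nat.le_succ s))]
  | succ n ih =>
    rw [torSuccVanishes_succ_iff (Submodule.injective_subtype _)
      (S.exact_subtype_rangeRestrict (hS s le_rfl)) (S.d s).surjective_rangeRestrict]
    exact ih (fun i hi => hS i (by omega)) (by omega)

lemma torSuccVanishes_iff_exact {N : Type u} [AddCommGroup N] [Module A N] (ε : S.X 0 →ₗ[A] N)
    (hε : Surjective ε) (h₀ : Exact (S.d 0) ε) (hS : ∀ i, Exact (S.d (i + 1)) (S.d i)) (n : ℕ) :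
    TorSuccVanishes A N n T ↔
      Exact ((S.d (n + 1)).lTensor T) ((S.d n).lTensor T) := by
  have h₁ : Exact (LinearMap.range (S.d 0)).subtype ε := fun x => by rw [h₀ x]; simp
  cases n with
  | zero =>
    rw [torSuccVanishes_zero_iff (Submodule.injective_subtype _) h₁ hε,
      ← exact_lTensor_iff_injective (hS 0)]
  | succ n =>
    rw [torSuccVanishes_succ_iff (Submodule.injective_subtype _) h₁ hε]
    exact S.torSuccVanishes_range_iff T (fun i _ => hS i) (by omega)

lemma eventuallyExact_tensor_iff (s : ℕ) (hS : ∀ i, s ≤ i → Exact (S.d (i + 1)) (S.d i)) :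
    (S.tensor T).EventuallyExact ↔
      ∃ n₀, ∀ n, n₀ ≤ n → TorSuccVanishes A (LinearMap.range (S.d s)) n T := by
  constructor
  · rintro ⟨n₀, h⟩
    exact ⟨n₀, fun n hn => (S.torSuccVanishes_range_iff T hS rfl).2 (h _ (by omega))⟩
  · rintro ⟨n₀, h⟩
    refine ⟨s + n₀ + 1, fun n hn => ?_⟩
    exact (S.torSuccVanishes_range_iff T (n := n - s - 1) hS (by omega)).1 (h _ (by omega))

end ModSeq

section Resolutions

variable {R : Type u} [CommRing R]

lemma moduleCat_projective_flat (X : ModuleCat.{u} R) [Projective X] : Module.Flat R X := by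
  have : Module.Projective R X := (IsProjective.iff_projective X).2 inferInstance
  infer_instance

lemma torIsZero_iff_exact (M : Type u) [AddCommGroup M] [Module R M] {N : Type u} [AddCommGroup N]
    [Module R N] (P : ProjectiveResolution (ModuleCat.of R N)) (n : ℕ) :
    TorIsZero R M N (n + 1) ↔ Exact ((P.complex.d (n + 2) (n + 1)).hom.lTensor M)
      ((P.complex.d (n + 1) n).hom.lTensor M) := by
  rw [TorIsZero, Tor_obj,
    (P.isoLeftDerivedObj ((MonoidalCategory.tensoringLeft (ModuleCat.{u} R)).obj
      (ModuleCat.of R M)) (n + 1)).isZero_iff]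
  change Limits.IsZero (HomologicalComplex.homology _ _) ↔ _
  rw [← HomologicalComplex.exactAt_iff_isZero_homology,
    HomologicalComplex.exactAt_iff' _ (n + 2) (n + 1) n (by simp) (by simp),
    ShortComplex.ShortExact.moduleCat_exact_iff_function_exact]
  rfl

/-- The sequence of modules underlying a projective resolution. -/
def modSeqOfResolution {N : ModuleCat.{u} R} (P : ProjectiveResolution N) : ModSeq R where
  X n := P.complex.X n
  d n := (P.complex.d (n + 1) n).hom
  d_d n x := by
    rw [← LinearMap.comp_apply, ← ModuleCat.hom_comp, P.complex.d_comp_d]; rfl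

lemma torIsZero_succ_iff (M : Type u) [AddCommGroup M] [Module R M] (N : Type u) [AddCommGroup N]
    [Module R N] (n : ℕ) : TorIsZero R M N (n + 1) ↔ TorSuccVanishes R N n M := by
  let P := ProjectiveResolution.of (ModuleCat.of R N)
  have : ∀ n, Module.Flat R ((modSeqOfResolution P).X n) := fun n =>
    moduleCat_projective_flat (P.complex.X n)
  let ε : P.complex.X 0 →ₗ[R] N := (P.π.f 0).hom
  have hε : Surjective ε := (ModuleCat.epi_iff_surjective (P.π.f 0)).1 inferInstance
  have h₀ : Exact (P.complex.d 1 0).hom ε :=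
    (ShortComplex.ShortExact.moduleCat_exact_iff_function_exact _).1 P.exact₀
  rw [torIsZero_iff_exact M P, (modSeqOfResolution P).torSuccVanishes_iff_exact M ε hε h₀
    (fun i => (ShortComplex.ShortExact.moduleCat_exact_iff_function_exact _).1 (P.exact_succ i)) n]
  rfl

lemma eventually_torIsZero_iff (M : Type u) [AddCommGroup M] [Module R M] (N : Type u)
    [AddCommGroup N] [Module R N] : (∃ n : ℕ, ∀ i, n < i → TorIsZero R M N i) ↔
      ∃ n₀, ∀ n, n₀ ≤ n → TorSuccVanishes R N n M := by
  constructor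
  · rintro ⟨n₀, h⟩
    exact ⟨n₀, fun n hn => (torIsZero_succ_iff M N n).1 (h _ (by omega))⟩
  · rintro ⟨n₀, h⟩
    refine ⟨n₀, fun i hi => ?_⟩
    obtain ⟨i, rfl⟩ : ∃ j, i = j + 1 := ⟨i - 1, by omega⟩
    exact (torIsZero_succ_iff M N i).2 (h _ (by omega))

lemma HasFiniteProjDim.eventually_torSuccVanishes {N : Type u} [AddCommGroup N] [Module R N]
    (h : HasFiniteProjDim R N) (T : Type u) [AddCommGroup T] [Module R T] :
    ∃ n₀, ∀ n, n₀ ≤ n → TorSuccVanishes R N n T := by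
  obtain ⟨n₀, P, hP⟩ := h
  refine ⟨n₀, fun n hn => ?_⟩
  rw [← torIsZero_succ_iff, torIsZero_iff_exact T P]
  have : Subsingleton (P.complex.X (n + 1)) :=
    ModuleCat.subsingleton_of_isZero (hP _ (by omega))
  intro x
  have hx : x = 0 := Subsingleton.elim _ _
  subst hx
  simp only [map_zero, true_iff]
  exact ⟨0, map_zero _⟩

end Resolutions

namespace ModSeq

variable {A : Type u} [CommRing A]

/-- `S` together with the augmentation `ε` is a resolution of `N`. -/
structure IsResolution (S : ModSeq A) {N : Type u} [AddCommGroup N] [Module A N]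
    (ε : S.X 0 →ₗ[A] N) : Prop where
  surjective : Surjective ε
  exact_zero : Exact (S.d 0) ε
  exact_succ : ∀ i, Exact (S.d (i + 1)) (S.d i)

/-- Extend a sequence on the right by one more term. -/
def cons (S : ModSeq A) (F : Type u) [AddCommGroup F] [Module A F] (f : S.X 0 →ₗ[A] F)
    (h : ∀ x, f (S.d 0 x) = 0) : ModSeq A where
  X n := Nat.casesOn n F S.X
  acg n := Nat.casesOn n (inferInstanceAs (AddCommGroup F)) S.acg
  mod n := Nat.casesOn n (inferInstanceAs (Module A F)) S.mod
  d n := match n with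
    | 0 => f
    | n + 1 => S.d n
  d_d n := match n with
    | 0 => h
    | n + 1 => S.d_d n

lemma IsResolution.cons {S : ModSeq A} {K F N : Type u} [AddCommGroup K] [Module A K]
    [AddCommGroup F] [Module A F] [AddCommGroup N] [Module A N] {ε : S.X 0 →ₗ[A] K}
    (h : S.IsResolution ε) {i : K →ₗ[A] F} {p : F →ₗ[A] N} (hi : Injective i) (hip : Exact i p)
    (hp : Surjective p) :
    (S.cons F (i ∘ₗ ε) (fun x => by
      rw [LinearMap.comp_apply, h.exact_zero.apply_apply_eq_zero, map_zero])).IsResolution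
      (N := N) p := by
  refine ⟨hp, ?_, ?_⟩
  · intro x
    refine (hip x).trans ⟨?_, ?_⟩
    · rintro ⟨y, rfl⟩
      obtain ⟨z, rfl⟩ := h.surjective y
      exact ⟨z, rfl⟩
    · rintro ⟨z, rfl⟩
      exact ⟨ε z, rfl⟩
  · rintro (_ | n)
    · intro x
      change i (ε x) = 0 ↔ _
      rw [map_eq_zero_iff _ hi]
      exact h.exact_zero x
    · exact h.exact_succ n

/-- The complex of modules attached to a sequence. -/
noncomputable def toChainComplex (S : ModSeq A) : ChainComplex (ModuleCat.{u} A) ℕ :=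
  ChainComplex.of (fun n => ModuleCat.of A (S.X n)) (fun n => ModuleCat.ofHom (S.d n))
    (fun n => by ext x; exact S.d_d n x)

lemma toChainComplex_d (S : ModSeq A) (n : ℕ) :
    S.toChainComplex.d (n + 1) n = ModuleCat.ofHom (S.d n) :=
  ChainComplex.of_d (fun n => ModuleCat.of A (S.X n)) (fun n => ModuleCat.ofHom (S.d n)) n

lemma IsResolution.exactAt_succ {S : ModSeq A} {N : Type u} [AddCommGroup N] [Module A N]
    {ε : S.X 0 →ₗ[A] N} (h : S.IsResolution ε) (n : ℕ) : S.toChainComplex.ExactAt (n + 1) := by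
  rw [HomologicalComplex.exactAt_iff' _ (n + 1 + 1) (n + 1) n (by simp) (by simp),
    ShortComplex.ShortExact.moduleCat_exact_iff_function_exact]
  change Exact (S.toChainComplex.d (n + 1 + 1) (n + 1)).hom (S.toChainComplex.d (n + 1) n).hom
  rw [toChainComplex_d, toChainComplex_d]
  exact h.exact_succ n

/-- The augmentation of the complex attached to a resolution. -/
noncomputable def IsResolution.augmentation {S : ModSeq A} {N : Type u} [AddCommGroup N]
    [Module A N] {ε : S.X 0 →ₗ[A] N} (h : S.IsResolution ε) :
    S.toChainComplex ⟶ (ChainComplex.single₀ (ModuleCat.{u} A)).obj (ModuleCat.of A N) :=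
  (ChainComplex.toSingle₀Equiv S.toChainComplex (ModuleCat.of A N)).symm
    ⟨ModuleCat.ofHom ε, by
      rw [toChainComplex_d]
      ext x
      exact h.exact_zero.apply_apply_eq_zero x⟩

lemma IsResolution.augmentation_f_zero {S : ModSeq A} {N : Type u} [AddCommGroup N]
    [Module A N] {ε : S.X 0 →ₗ[A] N} (h : S.IsResolution ε) :
    h.augmentation.f 0 = ModuleCat.ofHom ε :=
  ChainComplex.toSingle₀Equiv_symm_apply_f_zero _ _

/-- A resolution by projective modules, as a projective resolution in the category of modules. -/
noncomputable def IsResolution.projectiveResolution {S : ModSeq A} {N : Type u} [AddCommGroup N]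
    [Module A N] {ε : S.X 0 →ₗ[A] N} (h : S.IsResolution ε)
    (hS : ∀ n, Module.Projective A (S.X n)) : ProjectiveResolution (ModuleCat.of A N) where
  complex := S.toChainComplex
  projective n := (IsProjective.iff_projective (R := A) (P := S.X n)).1 (hS n)
  π := h.augmentation
  quasiIso := ⟨fun n => by
    cases n
    · rw [ChainComplex.quasiIsoAt₀_iff,
        ShortComplex.quasiIso_iff_of_zeros' _ (by simp; rfl) rfl rfl,
        ShortComplex.ShortExact.moduleCat_exact_iff_function_exact, ModuleCat.epi_iff_surjective]
      constructor
      · change Exact (S.toChainComplex.d 1 0).hom (h.augmentation.f 0).hom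
        rw [h.augmentation_f_zero, toChainComplex_d]
        exact h.exact_zero
      · change Surjective (h.augmentation.f 0).hom
        rw [h.augmentation_f_zero]
        exact h.surjective
    · rw [quasiIsoAt_iff_exactAt']
      · exact h.exactAt_succ _
      · apply ChainComplex.exactAt_succ_single_obj⟩

end ModSeq

section FiniteResolution

variable (A : Type u) [CommRing A]

/-- Existence of a resolution by projective modules that vanish in high degrees. -/
def HasFiniteResolution (N : Type u) [AddCommGroup N] [Module A N] : Prop :=
  ∃ (S : ModSeq A) (ε : S.X 0 →ₗ[A] N) (n₀ : ℕ), S.IsResolution ε ∧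
    (∀ n, Module.Projective A (S.X n)) ∧ ∀ n, n₀ < n → Subsingleton (S.X n)

variable {A}

lemma HasFiniteResolution.hasFiniteProjDim {N : Type u} [AddCommGroup N] [Module A N]
    (h : HasFiniteResolution A N) : HasFiniteProjDim A N := by
  obtain ⟨S, ε, n₀, h, hS, hn⟩ := h
  refine ⟨n₀, h.projectiveResolution hS, fun i hi => ?_⟩
  have := hn i hi
  exact ModuleCat.isZero_of_subsingleton (ModuleCat.of A (S.X i))

lemma HasFiniteResolution.of_exact {K F N : Type u} [AddCommGroup K] [Module A K]
    [AddCommGroup F] [Module A F] [AddCommGroup N] [Module A N] [Module.Projective A F]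
    {i : K →ₗ[A] F} {p : F →ₗ[A] N} (h : HasFiniteResolution A K) (hi : Injective i)
    (hip : Exact i p) (hp : Surjective p) : HasFiniteResolution A N := by
  obtain ⟨S, ε, n₀, h, hS, hn⟩ := h
  refine ⟨_, _, n₀ + 1, h.cons hi hip hp, ?_, ?_⟩
  · rintro (_ | n)
    · exact inferInstanceAs (Module.Projective A F)
    · exact hS n
  · rintro (_ | n) h
    · omega
    · exact hn n (by omega)

lemma HasFiniteResolution.of_subsingleton {N : Type u} [AddCommGroup N] [Module A N]
    [Subsingleton N] : HasFiniteResolution A N := by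
  refine ⟨{ X := fun _ => PUnit.{u + 1}, d := fun _ => 0, d_d := fun _ _ => rfl }, 0, 0,
    ⟨?_, ?_, ?_⟩,
    fun _ => ?_, fun _ _ => ?_⟩
  · exact fun x => ⟨0, Subsingleton.elim _ _⟩
  · exact fun x => ⟨fun _ => ⟨0, rfl⟩, fun _ => Subsingleton.elim _ _⟩
  · exact fun _ x => ⟨fun _ => ⟨0, rfl⟩, fun _ => rfl⟩
  · exact inferInstanceAs (Module.Projective A PUnit.{u + 1})
  · exact inferInstanceAs (Subsingleton PUnit.{u + 1})

lemma HasFiniteResolution.of_projective {N : Type u} [AddCommGroup N] [Module A N]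
    [Module.Projective A N] : HasFiniteResolution A N :=
  (HasFiniteResolution.of_subsingleton (N := PUnit.{u + 1})).of_exact (i := 0)
    (p := LinearMap.id (M := N)) (injective_of_subsingleton _)
    (fun _ => ⟨fun h => ⟨0, h.symm⟩, fun ⟨_, h⟩ => h.symm⟩) surjective_id

lemma hasFiniteResolution_of_torSuccVanishes [IsLocalRing A] [IsNoetherianRing A] {n : ℕ}
    {N : Type u} [AddCommGroup N] [Module A N] [Module.Finite A N]
    (h : TorSuccVanishes A N n (ResidueField A)) : HasFiniteResolution A N := by
  induction n generalizing N with
  | zero =>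
    obtain ⟨r, p, hp⟩ := Module.Finite.exists_fin' A N
    rw [torSuccVanishes_zero_iff (f := (LinearMap.ker p).subtype) (Submodule.injective_subtype _)
      (LinearMap.exact_subtype_ker_map p) hp] at h
    have := Module.free_of_lTensor_residueField_injective _ p hp
      (LinearMap.exact_subtype_ker_map p) h
    exact .of_projective
  | succ n ih =>
    obtain ⟨r, p, hp⟩ := Module.Finite.exists_fin' A N
    rw [torSuccVanishes_succ_iff (f := (LinearMap.ker p).subtype) (Submodule.injective_subtype _)
      (LinearMap.exact_subtype_ker_map p) hp] at h
    exact (ih h).of_exact (Submodule.injective_subtype _) (LinearMap.exact_subtype_ker_map p) hp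

lemma hasFiniteProjDim_of_torSuccVanishes [IsLocalRing A] [IsNoetherianRing A]
    {N : Type u} [AddCommGroup N] [Module A N] [Module.Finite A N]
    (h : ∃ n₀, ∀ n, n₀ ≤ n → TorSuccVanishes A N n (ResidueField A)) : HasFiniteProjDim A N :=
  let ⟨n₀, h⟩ := h
  (hasFiniteResolution_of_torSuccVanishes (h n₀ le_rfl)).hasFiniteProjDim

end FiniteResolution

section FreeResolution

variable (A : Type u) [CommRing A]

/-- A bundled finitely generated module. -/
structure FinMod where
  /-- The underlying type. -/
  carrier : Type u
  [acg : AddCommGroup carrier]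
  [mod : Module A carrier]
  [fin : Module.Finite A carrier]

attribute [instance] FinMod.acg FinMod.mod FinMod.fin

variable {A}

/-- The rank of a chosen finite free cover. -/
noncomputable def FinMod.rank (N : FinMod A) : ℕ :=
  (Module.Finite.exists_fin' A N.carrier).choose

/-- A chosen finite free cover. -/
noncomputable def FinMod.cover (N : FinMod A) : (Fin N.rank → A) →ₗ[A] N.carrier :=
  (Module.Finite.exists_fin' A N.carrier).choose_spec.choose

lemma FinMod.cover_surjective (N : FinMod A) : Surjective N.cover :=
  (Module.Finite.exists_fin' A N.carrier).choose_spec.choose_spec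

variable [IsNoetherianRing A]

/-- The iterated syzygies of a finitely generated module. -/
noncomputable def FinMod.syzygy (N : FinMod A) : ℕ → FinMod A
  | 0 => N
  | n + 1 => ⟨LinearMap.ker (N.syzygy n).cover⟩

/-- The resolution of a finitely generated module by its successive chosen finite free covers. -/
noncomputable def FinMod.freeModSeq (N : FinMod A) : ModSeq A where
  X n := Fin (N.syzygy n).rank → A
  d n := (LinearMap.ker (N.syzygy n).cover).subtype ∘ₗ (N.syzygy (n + 1)).cover
  d_d n x := by
    have h : (N.syzygy (n + 1)).cover (((N.syzygy (n + 2)).cover x).1) = 0 :=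
      ((N.syzygy (n + 2)).cover x).2
    exact congrArg Subtype.val h

lemma FinMod.freeModSeq_exact (N : FinMod A) (n : ℕ) :
    Exact (N.freeModSeq.d n) (N.syzygy n).cover := by
  intro x
  constructor
  · intro h
    obtain ⟨y, hy⟩ := (N.syzygy (n + 1)).cover_surjective ⟨x, h⟩
    exact ⟨y, congrArg Subtype.val hy⟩
  · rintro ⟨y, rfl⟩
    exact ((N.syzygy (n + 1)).cover y).2

lemma FinMod.freeModSeq_isResolution (N : FinMod A) :
    N.freeModSeq.IsResolution (N.syzygy 0).cover where
  surjective := N.cover_surjective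
  exact_zero := N.freeModSeq_exact 0
  exact_succ i x := by
    rw [← N.freeModSeq_exact (i + 1) x]
    exact ⟨fun h => Subtype.ext h, fun h => congrArg Subtype.val h⟩

lemma exists_finite_free_resolution (N : Type u) [AddCommGroup N] [Module A N]
    [Module.Finite A N] : ∃ (S : ModSeq A) (ε : S.X 0 →ₗ[A] N), S.IsResolution ε ∧
      ∀ n, Module.Finite A (S.X n) ∧ Module.Flat A (S.X n) :=
  ⟨_, _, (FinMod.mk N).freeModSeq_isResolution, fun _ =>
    ⟨inferInstanceAs (Module.Finite A (Fin _ → A)), inferInstanceAs (Module.Flat A (Fin _ → A))⟩⟩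

end FreeResolution

section BaseChange

variable {R : Type u} [CommRing R]

lemma rTensor_tensor_injective_iff (S : Type u) [AddCommGroup S] [Module R S]
    [Module.FaithfullyFlat R S] {N K G : Type u} [AddCommGroup N] [Module R N] [AddCommGroup K]
    [Module R K] [AddCommGroup G] [Module R G] (i : K →ₗ[R] G) :
    Injective (i.rTensor (S ⊗[R] N)) ↔ Injective (i.rTensor N) := by
  rw [← Module.FaithfullyFlat.lTensor_injective_iff_injective R S (i.rTensor N)]
  have h : (i.rTensor N).lTensor S ∘ₗ (TensorProduct.leftComm R K S N).toLinearMap =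
      (TensorProduct.leftComm R G S N).toLinearMap ∘ₗ i.rTensor (S ⊗[R] N) := by
    ext; simp
  have h1 := congrArg DFunLike.coe h
  simp only [LinearMap.coe_comp, LinearEquiv.coe_coe] at h1
  rw [← (TensorProduct.leftComm R G S N).injective.of_comp_iff, ← h1,
    Injective.of_comp_iff' _ (TensorProduct.leftComm R K S N).bijective]

lemma torSuccVanishes_faithfullyFlat_iff (S : Type u) [AddCommGroup S] [Module R S]
    [Module.FaithfullyFlat R S] {N T : Type u} [AddCommGroup N] [Module R N] [AddCommGroup T]
    [Module R T] (n : ℕ) : TorSuccVanishes R (S ⊗[R] N) n T ↔ TorSuccVanishes R N n T := by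
  induction n generalizing T with
  | zero =>
    have h := rTensor_tensor_injective_iff S (N := N) (K := tautSyzygy R T) (G := T →₀ R)
      (tautSyzygy R T).subtype
    exact h
  | succ n ih => exact ih

variable {A : Type u} [CommRing A] [Algebra R A]

lemma lTensor_baseChange_injective_iff {M B F : Type u} [AddCommGroup M] [Module R M]
    [AddCommGroup B] [Module R B] [Module A B] [IsScalarTower R A B]
    [AddCommGroup F] [Module R F] [Module A F] [IsScalarTower R A F] (f : B →ₗ[A] F) :
    Injective (f.lTensor (A ⊗[R] M)) ↔ Injective ((f.restrictScalars R).lTensor M) := by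
  rw [LinearMap.lTensor_inj_iff_rTensor_inj, LinearMap.lTensor_inj_iff_rTensor_inj]
  let eB := TensorProduct.AlgebraTensorModule.cancelBaseChange R A A B M
  let eF := TensorProduct.AlgebraTensorModule.cancelBaseChange R A A F M
  have h : ∀ x, (f.restrictScalars R).rTensor M (eB x) = eF (f.rTensor (A ⊗[R] M) x) := by
    intro x
    induction x using TensorProduct.induction_on with
    | zero => simp
    | add x y hx hy => simp only [map_add, hx, hy]
    | tmul b y =>
      induction y using TensorProduct.induction_on with
      | zero => simp
      | add x y hx hy => simp only [TensorProduct.tmul_add, map_add, hx, hy]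
      | tmul a m => simp [eB, eF]
  have h1 : (f.restrictScalars R).rTensor M ∘ eB = eF ∘ f.rTensor (A ⊗[R] M) := funext h
  rw [← eF.injective.of_comp_iff (f.rTensor (A ⊗[R] M)), ← h1,
    Injective.of_comp_iff' _ eB.bijective]

lemma torSuccVanishes_baseChange_iff [Module.Flat R A] {M N : Type u} [AddCommGroup M]
    [Module R M] [AddCommGroup N] [Module R N] [Module A N] [IsScalarTower R A N] (n : ℕ) :
    TorSuccVanishes A N n (A ⊗[R] M) ↔ TorSuccVanishes R N n M := by
  have hF : Module.Flat R (N →₀ A) := Module.Flat.trans R A (N →₀ A)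
  induction n generalizing N with
  | zero =>
    rw [torSuccVanishes_zero_iff (B := tautSyzygy A N) (f := (tautSyzygy A N).subtype)
        (Submodule.injective_subtype _) exact_tautSyzygy surjective_linearCombination_id,
      lTensor_baseChange_injective_iff (B := tautSyzygy A N) (tautSyzygy A N).subtype,
      torSuccVanishes_zero_iff (B := tautSyzygy A N)
        (f := (tautSyzygy A N).subtype.restrictScalars R)
        (g := (Finsupp.linearCombination A (id : N → N)).restrictScalars R)
        (Submodule.injective_subtype _) exact_tautSyzygy surjective_linearCombination_id]
  | succ n ih =>
    rw [torSuccVanishes_succ_iff (B := tautSyzygy A N) (f := (tautSyzygy A N).subtype)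
        (Submodule.injective_subtype _) exact_tautSyzygy surjective_linearCombination_id,
      torSuccVanishes_succ_iff (B := tautSyzygy A N)
        (f := (tautSyzygy A N).subtype.restrictScalars R)
        (g := (Finsupp.linearCombination A (id : N → N)).restrictScalars R)
        (Submodule.injective_subtype _) exact_tautSyzygy surjective_linearCombination_id]
    exact ih (N := tautSyzygy A N) (Module.Flat.trans R A _)

end BaseChange

section Noetherian

lemma exists_maximal_not_fg {A : Type u} [CommRing A] (h : ¬ IsNoetherianRing A) :
    ∃ P : Ideal A, Maximal (fun I : Ideal A => ¬ I.FG) P := by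
  rw [isNoetherianRing_iff_ideal_fg] at h
  push Not at h
  obtain ⟨I, hI⟩ := h
  have hC : ∀ C ⊆ {I : Ideal A | ¬ I.FG}, IsChain (· ≤ ·) C → ∀ J ∈ C, ¬ (sSup C).FG := by
    rintro C hC₁ hC₂ J hJ ⟨G, hG⟩
    obtain ⟨K, hK, hGK⟩ : ∃ K ∈ C, (G : Set A) ⊆ K := by
      refine hC₂.directedOn.exists_mem_subset_of_finset_subset_biUnion ⟨J, hJ⟩ (fun _ hx => ?_)
      simp only [Set.mem_iUnion, SetLike.mem_coe, exists_prop]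
      exact (Submodule.mem_sSup_of_directed ⟨J, hJ⟩ hC₂.directedOn).1 <|
        hG ▸ Submodule.subset_span hx
    refine hC₁ hK ⟨G, le_antisymm (Submodule.span_le.2 hGK) ?_⟩
    rw [hG]
    exact le_sSup hK
  obtain ⟨P, -, hP⟩ := zorn_le_nonempty₀ {I : Ideal A | ¬ I.FG}
    (fun C hC₁ hC₂ J hJ => ⟨sSup C, hC C hC₁ hC₂ J hJ, fun _ => le_sSup⟩) I hI
  exact ⟨P, hP⟩

variable {A : Type u} [CommRing A]

lemma mem_smul_top_pi_iff (I : Ideal A) {ι : Type*} [Finite ι] (x : ι → A) :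
    x ∈ (I • ⊤ : Submodule A (ι → A)) ↔ ∀ i, x i ∈ I := by
  classical
  have := Fintype.ofFinite ι
  constructor
  · intro h i
    refine Submodule.smul_induction_on (p := fun x => x i ∈ I) h (fun r hr y _ => ?_)
      (fun y z hy hz => add_mem hy hz)
    exact I.mul_mem_right _ hr
  · intro h
    rw [pi_eq_sum_univ' x]
    exact sum_mem fun i _ => Submodule.smul_mem_smul (h i) trivial

lemma isPrecomplete_pi (I : Ideal A) [IsPrecomplete I A] (ι : Type*) [Finite ι] :
    IsPrecomplete I (ι → A) where
  prec' f hf := by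
    have h : ∀ i, ∃ L : A, ∀ n, f n i ≡ L [SMOD (I ^ n • ⊤ : Submodule A A)] := by
      intro i
      refine IsPrecomplete.prec' (fun n => f n i) fun {m n} hmn => ?_
      have h1 := hf hmn
      rw [SModEq.sub_mem, mem_smul_top_pi_iff] at h1
      rw [SModEq.sub_mem]
      simpa using h1 i
    choose L hL using h
    refine ⟨L, fun n => ?_⟩
    rw [SModEq.sub_mem, mem_smul_top_pi_iff]
    intro i
    have h1 := hL i n
    rw [SModEq.sub_mem] at h1
    simpa using h1

lemma isHausdorff_submodule (I : Ideal A) {M : Type*} [AddCommGroup M] [Module A M]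
    [IsHausdorff I M] (P : Submodule A M) : IsHausdorff I P where
  haus' x hx := by
    refine Subtype.ext (IsHausdorff.haus ‹IsHausdorff I M› x.1 fun n => ?_)
    have h := hx n
    rw [SModEq.zero] at h ⊢
    have h1 := Submodule.mem_map_of_mem (f := P.subtype) h
    rw [Submodule.map_smul''] at h1
    exact Submodule.smul_mono le_rfl le_top h1

lemma isNoetherianRing_of_isAdicComplete [IsLocalRing A] (hfg : (maximalIdeal A).FG)
    [IsAdicComplete (maximalIdeal A) A] : IsNoetherianRing A := by
  by_contra hA
  obtain ⟨P, hP⟩ := exists_maximal_not_fg hA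
  have hprime : P.IsPrime := Ideal.isOka_fg.isPrime_of_maximal_not hP
  refine hP.prop ?_
  by_cases hm : maximalIdeal A ≤ P
  · rwa [← (maximalIdeal.isMaximal A).eq_of_le hprime.ne_top hm]
  obtain ⟨x, hxm, hxP⟩ := Set.not_subset.1 hm
  have hfg' : (P ⊔ Ideal.span {x}).FG :=
    of_not_not (hP.not_prop_of_gt (Submodule.lt_sup_iff_notMem.2 hxP))
  obtain ⟨r, g, hg⟩ := Submodule.fg_iff_exists_fin_generating_family.1 hfg'
  have h : ∀ i, ∃ p : P, ∃ a : A, p.1 + a * x = g i := by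
    intro i
    have : g i ∈ P ⊔ Ideal.span {x} := hg ▸ Submodule.subset_span ⟨i, rfl⟩
    rw [Submodule.mem_sup] at this
    obtain ⟨p, hp, y, hy, h⟩ := this
    obtain ⟨a, rfl⟩ := Ideal.mem_span_singleton'.1 hy
    exact ⟨⟨p, hp⟩, a, h⟩
  choose p a hpa using h
  let f : (Fin r → A) →ₗ[A] P := Fintype.linearCombination A p
  have := isPrecomplete_pi (maximalIdeal A) (Fin r)
  have := isHausdorff_submodule (maximalIdeal A) P
  have hf : Surjective f := by
    refine surjective_of_mkQ_comp_surjective (I := maximalIdeal A) fun y => ?_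
    obtain ⟨y, rfl⟩ := Submodule.mkQ_surjective _ y
    have hy : y.1 ∈ Submodule.span A (Set.range g) := hg ▸ Ideal.mem_sup_left y.2
    obtain ⟨c, hc⟩ := (Submodule.mem_span_range_iff_exists_fun A).1 hy
    refine ⟨c, ?_⟩
    rw [LinearMap.comp_apply, ← sub_eq_zero, ← map_sub, Submodule.mkQ_apply,
      Submodule.Quotient.mk_eq_zero, ← neg_mem_iff, neg_sub]
    have h1 : (y - f c).1 = x * ∑ i, c i * a i := by
      simp only [f, Fintype.linearCombination_apply, Submodule.coe_sub, Submodule.coe_sum,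
        Submodule.coe_smul, ← hc, smul_eq_mul, ← Finset.sum_sub_distrib, Finset.mul_sum, ← hpa]
      exact Finset.sum_congr rfl fun i _ => by ring
    have h2 : ∑ i, c i * a i ∈ P :=
      (hprime.mem_or_mem (h1 ▸ (y - f c).2)).resolve_left hxP
    have h3 : y - f c = x • (⟨_, h2⟩ : P) := Subtype.ext h1
    rw [h3]
    exact Submodule.smul_mem_smul hxm trivial
  exact Module.Finite.iff_fg.1 (Module.Finite.of_surjective f hf)

variable (R : Type u) [CommRing R] [IsLocalRing R] [IsNoetherianRing R]

instance isNoetherianRing_adicCompletion :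
    IsNoetherianRing (AdicCompletion (maximalIdeal R) R) := by
  refine isNoetherianRing_of_isAdicComplete ?_
  rw [AdicCompletion.maximalIdeal_eq_map]
  exact ((maximalIdeal R).fg_of_isNoetherianRing).map _

instance faithfullyFlat_adicCompletion :
    Module.FaithfullyFlat R (AdicCompletion (maximalIdeal R) R) :=
  Module.FaithfullyFlat.of_flat_of_isLocalHom

/-- The residue field of a local ring agrees with the base change of the residue field of a
subring whose maximal ideal generates the maximal ideal. -/
noncomputable def tensorResidueFieldEquiv {R A : Type u} [CommRing R] [IsLocalRing R]
    [CommRing A] [IsLocalRing A] [Algebra R A]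
    (h : maximalIdeal A = (maximalIdeal R).map (algebraMap R A)) :
    (A ⊗[R] ResidueField R) ≃ₗ[A] ResidueField A :=
  (Algebra.TensorProduct.quotIdealMapEquivTensorQuot A (maximalIdeal R)).symm.toLinearEquiv ≪≫ₗ
    Submodule.quotEquivOfEq _ _ h.symm

end Noetherian

lemma flat_prod {A : Type u} [CommRing A] (X Y : Type u) [AddCommGroup X] [Module A X]
    [AddCommGroup Y] [Module A Y] [Module.Flat A X] [Module.Flat A Y] :
    Module.Flat A (X × Y) := by
  rw [Module.Flat.iff_rTensor_preserves_injective_linearMap]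
  intro N N' _ _ _ _ f hf
  have h : (TensorProduct.prodRight A A N' X Y).toLinearMap ∘ₗ f.rTensor (X × Y) =
      (f.rTensor X).prodMap (f.rTensor Y) ∘ₗ
        (TensorProduct.prodRight A A N X Y).toLinearMap := by
    refine TensorProduct.ext' fun t p => ?_
    simp
  have hi : Injective ((f.rTensor X).prodMap (f.rTensor Y) ∘ₗ
      (TensorProduct.prodRight A A N X Y).toLinearMap) := by
    rw [LinearMap.coe_comp, LinearMap.coe_prodMap]
    exact ((Module.Flat.rTensor_preserves_injective_linearMap f hf).prodMap
      (Module.Flat.rTensor_preserves_injective_linearMap f hf)).comp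
        (TensorProduct.prodRight A A N X Y).injective
  rw [← h, LinearMap.coe_comp] at hi
  exact hi.of_comp

namespace ModSeq

variable {A : Type u} [CommRing A]

/-- The mapping cone of multiplication by `x`, indexed so that its lowest term is dropped. -/
def cone (x : A) (S : ModSeq A) : ModSeq A where
  X n := S.X (n + 1) × S.X n
  d n := ((S.d (n + 1)).coprod (x • LinearMap.id)).prod (-(S.d n ∘ₗ LinearMap.snd A _ _))
  d_d n p := by
    ext <;> simp [S.d_d]

lemma cone_d_apply (x : A) (S : ModSeq A) (n : ℕ) (a : S.X (n + 2)) (b : S.X (n + 1)) :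
    (S.cone x).d n (a, b) = (S.d (n + 1) a + x • b, -S.d n b) := rfl

lemma EventuallyExact.cone {S : ModSeq A} (h : S.EventuallyExact) (x : A) :
    (S.cone x).EventuallyExact := by
  obtain ⟨n₀, h⟩ := h
  refine ⟨n₀, fun n hn => ?_⟩
  rintro ⟨a, b⟩
  refine ⟨fun hab => ?_, ?_⟩
  · have h1 : S.d (n + 1) a + x • b = 0 := congrArg Prod.fst hab
    have h2 : -S.d n b = 0 := congrArg Prod.snd hab
    obtain ⟨c, rfl⟩ := (h n hn b).1 (neg_eq_zero.1 h2)
    obtain ⟨e, he⟩ := (h (n + 1) (by omega) (a + x • c)).1 (by rw [map_add, map_smul, h1])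
    refine ⟨(e, -c), ?_⟩
    rw [cone_d_apply, he]
    simp
    rfl
  · rintro ⟨p, hp⟩
    rw [← hp]
    exact (S.cone x).d_d n p

lemma EventuallyExact.of_cone {S : ModSeq A} {x : A} (h : (S.cone x).EventuallyExact)
    (hx : ∀ n, ∀ a : S.X n, x • a = 0) : S.EventuallyExact := by
  obtain ⟨n₀, h⟩ := h
  refine ⟨n₀, fun n hn b => ⟨fun hb => ?_, ?_⟩⟩
  · obtain ⟨⟨e, c⟩, hc⟩ := (h n hn (0, b)).1 (by
      rw [cone_d_apply, hb, hx, map_zero, add_zero, neg_zero]; rfl)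
    rw [cone_d_apply] at hc
    exact ⟨-c, by rw [map_neg]; exact congrArg Prod.snd hc⟩
  · rintro ⟨c, rfl⟩
    exact S.d_d n c

lemma eventuallyExact_congr {S S' : ModSeq A} (e : ∀ n, S.X n ≃ₗ[A] S'.X n)
    (he : ∀ n x, e n (S.d n x) = S'.d n (e (n + 1) x)) (h : S.EventuallyExact) :
    S'.EventuallyExact := by
  obtain ⟨n₀, h⟩ := h
  refine ⟨n₀, fun n hn y => ?_⟩
  obtain ⟨x, rfl⟩ := (e (n + 1)).surjective y
  rw [← he, LinearEquiv.map_eq_zero_iff, h n hn x]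
  constructor
  · rintro ⟨z, rfl⟩
    exact ⟨e (n + 2) z, (he (n + 1) z).symm⟩
  · rintro ⟨z, hz⟩
    obtain ⟨w, rfl⟩ := (e (n + 2)).surjective z
    rw [← he] at hz
    exact ⟨w, (e (n + 1)).injective hz⟩

lemma eventuallyExact_tensor_cone_iff (S : ModSeq A) (x : A) (T : Type u) [AddCommGroup T]
    [Module A T] : ((S.cone x).tensor T).EventuallyExact ↔
      ((S.tensor T).cone x).EventuallyExact := by
  let e : ∀ n, ((S.cone x).tensor T).X n ≃ₗ[A] ((S.tensor T).cone x).X n := fun n =>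
    TensorProduct.prodRight A A T (S.X (n + 1)) (S.X n)
  have he : ∀ n y, e n (((S.cone x).tensor T).d n y) = ((S.tensor T).cone x).d n (e (n + 1) y) := by
    intro n y
    have h : (e n).toLinearMap ∘ₗ ((S.cone x).tensor T).d n =
        ((S.tensor T).cone x).d n ∘ₗ (e (n + 1)).toLinearMap := by
      refine TensorProduct.ext' fun t p => ?_
      obtain ⟨a, b⟩ := p
      change (t ⊗ₜ[A] (S.d (n + 1) a + x • b), t ⊗ₜ[A] (-S.d n b)) =
        (t ⊗ₜ[A] (S.d (n + 1) a) + x • (t ⊗ₜ[A] b), -(t ⊗ₜ[A] S.d n b))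
      rw [TensorProduct.tmul_add, TensorProduct.tmul_smul, TensorProduct.tmul_neg]
    exact LinearMap.congr_fun h y
  refine ⟨eventuallyExact_congr e he, eventuallyExact_congr (fun n => (e n).symm) fun n y => ?_⟩
  rw [LinearEquiv.symm_apply_eq, he, LinearEquiv.apply_symm_apply]

/-- Multiplication by `y` is null-homotopic in positive degrees. -/
def NullHomotopic (y : A) (S : ModSeq A) : Prop :=
  ∃ h : ∀ n, S.X n →ₗ[A] S.X (n + 1),
    ∀ n a, S.d (n + 1) (h (n + 1) a) + h n (S.d n a) = y • a

lemma nullHomotopic_cone (x : A) (S : ModSeq A) : (S.cone x).NullHomotopic x := by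
  refine ⟨fun n => LinearMap.prod 0 (LinearMap.fst A (S.X (n + 1)) (S.X n)), ?_⟩
  rintro n ⟨a, b⟩
  change ((S.d (n + 2) 0 + x • a, -S.d (n + 1) a) : S.X (n + 2) × S.X (n + 1)) +
    ((0, S.d (n + 1) a + x • b) : S.X (n + 2) × S.X (n + 1)) = (x • a, x • b)
  ext <;> simp

lemma NullHomotopic.cone {y : A} {S : ModSeq A} (h : S.NullHomotopic y) (x : A) :
    (S.cone x).NullHomotopic y := by
  obtain ⟨h, hh⟩ := h
  refine ⟨fun n => (h (n + 1)).prodMap (-h n), ?_⟩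
  rintro n ⟨a, b⟩
  change ((S.d (n + 2) (h (n + 2) a) + x • (-h (n + 1) b), -S.d (n + 1) (-h (n + 1) b)) :
    S.X (n + 2) × S.X (n + 1)) + (h (n + 1) (S.d (n + 1) a + x • b), -h n (-S.d n b)) =
      (y • a, y • b)
  rw [← hh, ← hh]
  ext
  · simp; abel
  · simp

lemma NullHomotopic.smul_mem {y : A} {S : ModSeq A} (h : S.NullHomotopic y) (n : ℕ)
    {a : S.X (n + 1)} (ha : S.d n a = 0) : y • a ∈ LinearMap.range (S.d (n + 1)) := by
  obtain ⟨h, hh⟩ := h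
  exact ⟨h (n + 1) a, by rw [← hh, ha, map_zero, add_zero]⟩

/-- Terms are finitely generated and flat. -/
def FiniteFlat (S : ModSeq A) : Prop :=
  ∀ n, Module.Finite A (S.X n) ∧ Module.Flat A (S.X n)

lemma FiniteFlat.cone {S : ModSeq A} (h : S.FiniteFlat) (x : A) : (S.cone x).FiniteFlat := by
  intro n
  have := (h n).1
  have := (h n).2
  have := (h (n + 1)).1
  have := (h (n + 1)).2
  exact ⟨inferInstanceAs (Module.Finite A (S.X (n + 1) × S.X n)),
    flat_prod (S.X (n + 1)) (S.X n)⟩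

lemma exists_iterated_cone (l : List A) (S : ModSeq A) (hS : S.FiniteFlat)
    (h0 : ∀ j ≤ l.length, Subsingleton (S.X j)) :
    ∃ K : ModSeq A, K.FiniteFlat ∧ Subsingleton (K.X 0) ∧
      (∀ y, S.NullHomotopic y ∨ y ∈ l → K.NullHomotopic y) ∧
      (S.EventuallyExact → K.EventuallyExact) ∧
      ∀ (T : Type u) [AddCommGroup T] [Module A T],
        ((S.tensor T).EventuallyExact → (K.tensor T).EventuallyExact) ∧
        ((∀ y ∈ l, ∀ t : T, y • t = 0) →
          (K.tensor T).EventuallyExact → (S.tensor T).EventuallyExact) := by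
  induction l generalizing S with
  | nil =>
    exact ⟨S, hS, h0 0 le_rfl, fun y hy => hy.resolve_right List.not_mem_nil, id,
      fun T _ _ => ⟨id, fun _ => id⟩⟩
  | cons x l ih =>
    obtain ⟨K, hK, hK0, hN, hE, hT⟩ := ih (S.cone x) (hS.cone x) (fun j hj => by
      have := h0 j (by simp; omega)
      have := h0 (j + 1) (by simp; omega)
      exact inferInstanceAs (Subsingleton (S.X (j + 1) × S.X j)))
    refine ⟨K, hK, hK0, ?_, fun h => hE (h.cone x), fun T _ _ => ⟨fun h => ?_, fun hy h => ?_⟩⟩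
    · rintro y (hy | hy)
      · exact hN y (Or.inl (hy.cone x))
      · rcases List.mem_cons.1 hy with rfl | hy
        · exact hN y (Or.inl (nullHomotopic_cone y S))
        · exact hN y (Or.inr hy)
    · exact (hT T).1 ((S.eventuallyExact_tensor_cone_iff x T).2 (h.cone x))
    · refine ((S.eventuallyExact_tensor_cone_iff x T).1
        ((hT T).2 (fun y hl => hy y (List.mem_cons_of_mem _ hl)) h)).of_cone fun n a => ?_
      suffices h : ∀ a : T ⊗[A] S.X n, x • a = 0 from h a
      intro a
      induction a using TensorProduct.induction_on with
      | zero => exact smul_zero x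
      | add a b ha hb => rw [smul_add, ha, hb, add_zero]
      | tmul t a =>
        rw [TensorProduct.smul_tmul', hy x List.mem_cons_self, TensorProduct.zero_tmul]

lemma exists_prepend (m : ℕ) (S : ModSeq A) (hS : S.FiniteFlat) :
    ∃ K : ModSeq A, K.FiniteFlat ∧ (∀ j < m, Subsingleton (K.X j)) ∧
      (S.EventuallyExact → K.EventuallyExact) ∧
      ∀ (T : Type u) [AddCommGroup T] [Module A T],
        (S.tensor T).EventuallyExact ↔ (K.tensor T).EventuallyExact := by
  induction m with
  | zero => exact ⟨S, hS, by simp, id, fun T _ _ => Iff.rfl⟩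
  | succ m ih =>
    obtain ⟨K, hK, h0, hE, hT⟩ := ih
    let K' := K.cons PUnit.{u + 1} 0 (fun _ => rfl)
    refine ⟨K', ?_, ?_, fun h => ?_, fun T _ _ => (hT T).trans ⟨?_, ?_⟩⟩
    · rintro (_ | n)
      · exact ⟨inferInstanceAs (Module.Finite A PUnit.{u + 1}),
          inferInstanceAs (Module.Flat A PUnit.{u + 1})⟩
      · exact hK n
    · rintro (_ | j) hj
      · exact inferInstanceAs (Subsingleton PUnit.{u + 1})
      · exact h0 j (by omega)
    · obtain ⟨n₀, h⟩ := hE h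
      refine ⟨n₀ + 1, ?_⟩
      rintro (_ | n) hn
      · omega
      · exact h n (by omega)
    · rintro ⟨n₀, h⟩
      refine ⟨n₀ + 1, ?_⟩
      rintro (_ | n) hn
      · omega
      · exact h n (by omega)
    · rintro ⟨n₀, h⟩
      exact ⟨n₀, fun n hn => h (n + 1) (by omega)⟩

/-- Replace a sequence by one whose positive homology is killed by a finitely generated ideal. -/
lemma exists_koszul {I : Ideal A} (hI : I.FG) (S : ModSeq A) (hS : S.FiniteFlat) :
    ∃ K : ModSeq A, K.FiniteFlat ∧ Subsingleton (K.X 0) ∧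
      (∀ n, ∀ y ∈ I, ∀ a, K.d n a = 0 → y • a ∈ LinearMap.range (K.d (n + 1))) ∧
      (S.EventuallyExact → K.EventuallyExact) ∧
      ∀ (T : Type u) [AddCommGroup T] [Module A T],
        ((S.tensor T).EventuallyExact → (K.tensor T).EventuallyExact) ∧
        ((∀ y ∈ I, ∀ t : T, y • t = 0) →
          (K.tensor T).EventuallyExact → (S.tensor T).EventuallyExact) := by
  obtain ⟨s, rfl⟩ := hI
  obtain ⟨S', hS', h0, hE', hT'⟩ := exists_prepend (s.toList.length + 1) S hS
  obtain ⟨K, hK, hK0, hN, hE, hT⟩ := exists_iterated_cone s.toList S' hS'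
    (fun j hj => h0 j (by omega))
  refine ⟨K, hK, hK0, fun n y hy a ha => ?_, fun h => hE (hE' h), fun T _ _ =>
    ⟨fun h => (hT T).1 ((hT' T).1 h), fun h hK => (hT' T).2 ((hT T).2 (fun y hy => ?_) hK)⟩⟩
  · induction hy using Submodule.span_induction with
    | mem y hy => exact (hN y (Or.inr (by simpa using hy))).smul_mem n ha
    | zero => rw [zero_smul]; exact zero_mem _
    | add y z _ _ hy hz => rw [add_smul]; exact add_mem hy hz
    | smul r y _ hy => rw [smul_assoc]; exact Submodule.smul_mem _ r hy
  · exact h y (Submodule.subset_span (by simpa using hy))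

end ModSeq

section FlatWithFiniteCokernel

variable {R : Type u} [CommRing R]

/-- A submodule of a flat module is flat if the quotient is flat. -/
lemma flat_of_exact {K X Y : Type u} [AddCommGroup K] [Module R K] [AddCommGroup X] [Module R X]
    [AddCommGroup Y] [Module R Y] [Module.Flat R X] [Module.Flat R Y] {f : K →ₗ[R] X}
    {g : X →ₗ[R] Y} (hf : Injective f) (hfg : Exact f g) (hg : Surjective g) :
    Module.Flat R K := by
  rw [Module.Flat.iff_rTensor_preserves_injective_linearMap]
  intro T T' _ _ _ _ i hi
  have hT : Injective (f.lTensor T) := (torSuccVanishes_zero_iff hf hfg hg).1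
    (Module.Flat.rTensor_preserves_injective_linearMap _ (Submodule.injective_subtype _))
  have h : Injective (i.rTensor X ∘ₗ f.lTensor T) := by
    rw [LinearMap.coe_comp]
    exact (Module.Flat.rTensor_preserves_injective_linearMap i hi).comp hT
  rw [LinearMap.rTensor_comp_lTensor, ← LinearMap.lTensor_comp_rTensor, LinearMap.coe_comp] at h
  exact h.of_comp

variable (R) in
/-- `B` embeds into a flat module with finitely generated cokernel. -/
def EmbedsInFlatWithFiniteCokernel (B : Type u) [AddCommGroup B] [Module R B] : Prop :=
  ∃ (Y : Type u) (_ : AddCommGroup Y) (_ : Module R Y) (_ : Module.Flat R Y) (f : B →ₗ[R] Y)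
    (G : Submodule R Y), Injective f ∧ G.FG ∧ LinearMap.range f ⊔ G = ⊤

namespace EmbedsInFlatWithFiniteCokernel

lemma of_subsingleton (B : Type u) [AddCommGroup B] [Module R B] [Subsingleton B] :
    EmbedsInFlatWithFiniteCokernel R B :=
  ⟨PUnit.{u + 1}, inferInstance, inferInstance, inferInstance, 0, ⊥,
    injective_of_subsingleton _, Submodule.fg_bot, Subsingleton.elim _ _⟩

lemma of_injective {B Z : Type u} [AddCommGroup B] [Module R B] [AddCommGroup Z] [Module R Z]
    (h : EmbedsInFlatWithFiniteCokernel R Z) {i : B →ₗ[R] Z} (hi : Injective i)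
    {G : Submodule R Z} (hG : G.FG) (hiG : LinearMap.range i ⊔ G = ⊤) :
    EmbedsInFlatWithFiniteCokernel R B := by
  obtain ⟨Y, _, _, _, f, H, hf, hH, hfH⟩ := h
  refine ⟨Y, _, _, inferInstance, f ∘ₗ i, G.map f ⊔ H, hf.comp hi, (hG.map f).sup hH, ?_⟩
  rw [← sup_assoc, LinearMap.range_comp, ← Submodule.map_sup, hiG, Submodule.map_top, hfH]

/-- The property passes to the kernel of a surjection from a flat module. -/
lemma of_exact [IsNoetherianRing R] {K X B : Type u} [AddCommGroup K] [Module R K]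
    [AddCommGroup X] [Module R X] [Module.Flat R X] [AddCommGroup B] [Module R B]
    (h : EmbedsInFlatWithFiniteCokernel R B) {j : K →ₗ[R] X} {p : X →ₗ[R] B}
    (hj : Injective j) (hjp : Exact j p) (hp : Surjective p) :
    EmbedsInFlatWithFiniteCokernel R K := by
  obtain ⟨Y, _, _, _, f, G, hf, hG, hfG⟩ := h
  obtain ⟨n, c, rfl⟩ := (Submodule.fg_iff_exists_fin_linearMap _ _).1 hG
  let g : X × (Fin n → R) →ₗ[R] Y := (f ∘ₗ p).coprod c
  have hg : Surjective g := by
    intro y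
    have hy : y ∈ LinearMap.range f ⊔ LinearMap.range c := hfG ▸ Submodule.mem_top
    obtain ⟨_, ⟨b, rfl⟩, _, ⟨v, rfl⟩, rfl⟩ := Submodule.mem_sup.1 hy
    obtain ⟨x, rfl⟩ := hp b
    exact ⟨(x, v), rfl⟩
  have := flat_prod (A := R) X (Fin n → R)
  have hflat : Module.Flat R (LinearMap.ker g) :=
    flat_of_exact (Submodule.injective_subtype _) (LinearMap.exact_subtype_ker_map g) hg
  let i : K →ₗ[R] LinearMap.ker g := (LinearMap.inl R X (Fin n → R) ∘ₗ j).codRestrict _ (by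
    intro z
    simp [g, hjp.apply_apply_eq_zero])
  let φ : LinearMap.ker g →ₗ[R] (Fin n → R) := LinearMap.snd R X _ ∘ₗ (LinearMap.ker g).subtype
  obtain ⟨m, s, hs⟩ := Module.Finite.exists_fin' R (LinearMap.range φ)
  obtain ⟨t, ht⟩ := Module.projective_lifting_property φ.rangeRestrict s
    φ.surjective_rangeRestrict
  refine ⟨LinearMap.ker g, _, _, hflat, i, LinearMap.range t, ?_, ?_, ?_⟩
  · intro x y hxy
    exact hj (congrArg (fun z : LinearMap.ker g => z.1.1) hxy)
  · exact (Submodule.fg_iff_exists_fin_linearMap _ _).2 ⟨m, t, rfl⟩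
  · refine eq_top_iff.2 fun q _ => ?_
    obtain ⟨v, hv⟩ := hs (φ.rangeRestrict q)
    have h0 : φ (q - t v) = 0 := by
      rw [map_sub, sub_eq_zero]
      have := LinearMap.congr_fun ht v
      exact (congrArg Subtype.val (this.trans hv)).symm
    have h1 : q - t v ∈ LinearMap.range i := by
      generalize q - t v = z at h0 ⊢
      obtain ⟨⟨x, w⟩, hw⟩ := z
      obtain rfl : w = 0 := h0
      have h2 : f (p x) + c 0 = 0 := hw
      rw [map_zero, add_zero, map_eq_zero_iff f hf] at h2
      obtain ⟨z, rfl⟩ := (hjp x).1 h2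
      exact ⟨z, rfl⟩
    rw [← sub_add_cancel q (t v)]
    exact Submodule.add_mem_sup h1 ⟨v, rfl⟩

end EmbedsInFlatWithFiniteCokernel

/-- If `A` is generated by `R` modulo an ideal that kills the homology of a sequence of finite flat
modules, the boundaries embed into `R`-flat modules with finitely generated cokernel. -/
lemma ModSeq.embedsInFlatWithFiniteCokernel_range [IsNoetherianRing R] {A : Type u} [CommRing A]
    [IsNoetherianRing A] [Algebra R A] [Module.Flat R A] {I : Ideal A}
    (hI : ∀ a : A, ∃ r : R, a - algebraMap R A r ∈ I) (K : ModSeq A) (hK : K.FiniteFlat)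
    [∀ n, Module R (K.X n)] [∀ n, IsScalarTower R A (K.X n)] (h0 : Subsingleton (K.X 0))
    (hd : ∀ n, ∀ y ∈ I, ∀ a, K.d n a = 0 → y • a ∈ LinearMap.range (K.d (n + 1))) (n : ℕ) :
    EmbedsInFlatWithFiniteCokernel R (LinearMap.range (K.d n)) := by
  induction n with
  | zero => exact .of_subsingleton _
  | succ n ih =>
    have := (hK (n + 1)).1
    have := (hK (n + 1)).2
    have : Module.Flat R (K.X (n + 1)) := Module.Flat.trans R A _
    have hZ : EmbedsInFlatWithFiniteCokernel R (LinearMap.ker (K.d n)) := by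
      refine ih.of_exact (j := (LinearMap.ker (K.d n)).subtype.restrictScalars R)
        (p := (K.d n).rangeRestrict.restrictScalars R) (Submodule.injective_subtype _) ?_
        (K.d n).surjective_rangeRestrict
      intro x
      refine Iff.trans ?_ (LinearMap.exact_subtype_ker_map (K.d n) x)
      exact Subtype.ext_iff
    have hle : LinearMap.range (K.d (n + 1)) ≤ LinearMap.ker (K.d n) := by
      rintro _ ⟨x, rfl⟩
      exact K.d_d n x
    obtain ⟨s, hs⟩ := Module.Finite.fg_top (R := A) (M := LinearMap.ker (K.d n))
    refine hZ.of_injective (i := (Submodule.inclusion hle).restrictScalars R)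
      (Submodule.inclusion_injective hle) (G := Submodule.span R s) ⟨s, rfl⟩
      (eq_top_iff.2 fun x _ => ?_)
    have hx : x ∈ Submodule.span A (s : Set (LinearMap.ker (K.d n))) := hs ▸ Submodule.mem_top
    induction hx using Submodule.span_induction with
    | mem x hx => exact Submodule.mem_sup_right (Submodule.subset_span hx)
    | zero => exact zero_mem _
    | add x y _ _ hx hy => exact add_mem (hx trivial) (hy trivial)
    | smul a x _ hx =>
      obtain ⟨r, hr⟩ := hI a
      rw [← sub_add_cancel a (algebraMap R A r), add_smul, algebraMap_smul]
      refine add_mem (Submodule.mem_sup_left ?_) (Submodule.smul_mem _ r (hx trivial))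
      exact ⟨⟨_, hd n _ hr x.1 x.2⟩, rfl⟩

end FlatWithFiniteCokernel

section PdTest

variable {R A : Type u} [CommRing R] [CommRing A] {M : Type u} [AddCommGroup M]
  [Module R M]

/-- A pd-test module detects eventual Tor-vanishing of the modules that embed into a flat module
with finitely generated cokernel. -/
lemma EmbedsInFlatWithFiniteCokernel.eventually_torSuccVanishes {B : Type u} [AddCommGroup B]
    [Module R B] (hB : EmbedsInFlatWithFiniteCokernel R B) (hM : IsPdTest R M)
    (h : ∃ n₀, ∀ n, n₀ ≤ n → TorSuccVanishes R B n M) (T : Type u) [AddCommGroup T]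
    [Module R T] : ∃ n₀, ∀ n, n₀ ≤ n → TorSuccVanishes R B n T := by
  obtain ⟨Y, _, _, _, f, G, hf, hG, hfG⟩ := hB
  let C := Y ⧸ LinearMap.range f
  have hfg : Exact f (LinearMap.range f).mkQ := LinearMap.exact_map_mkQ_range f
  have hs : Surjective (LinearMap.range f).mkQ := Submodule.mkQ_surjective _
  have hC : Module.Finite R C := by
    refine ⟨?_⟩
    have h := congrArg (Submodule.map (LinearMap.range f).mkQ) hfG
    rw [Submodule.map_sup, Submodule.map_top, Submodule.range_mkQ, Submodule.mkQ_map_self,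
      bot_sup_eq] at h
    exact h ▸ hG.map _
  have hpd : HasFiniteProjDim R C := by
    refine hM C hC ((eventually_torIsZero_iff M C).2 ?_)
    obtain ⟨n₀, h⟩ := h
    refine ⟨n₀ + 1, ?_⟩
    rintro (_ | n) hn
    · omega
    · exact (torSuccVanishes_succ_iff hf hfg hs n).2 (h n (by omega))
  obtain ⟨n₀, h⟩ := hpd.eventually_torSuccVanishes T
  exact ⟨n₀, fun n hn => (torSuccVanishes_succ_iff hf hfg hs n).1 (h _ (by omega))⟩

lemma ModSeq.IsResolution.eventuallyExact_tensor_iff {S : ModSeq A} {N : Type u} [AddCommGroup N]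
    [Module A N] {ε : S.X 0 →ₗ[A] N} (h : S.IsResolution ε) (hS : S.FiniteFlat) (T : Type u)
    [AddCommGroup T] [Module A T] :
    (S.tensor T).EventuallyExact ↔ ∃ n₀, ∀ n, n₀ ≤ n → TorSuccVanishes A N n T := by
  have := fun n => (hS n).2
  simp only [S.torSuccVanishes_iff_exact T ε h.surjective h.exact_zero h.exact_succ]
  exact Iff.rfl

variable [IsLocalRing R] [IsNoetherianRing R] [Algebra R A] [Module.FaithfullyFlat R A]

lemma IsPdTest.of_baseChange (h : IsPdTest A (A ⊗[R] M)) : IsPdTest R M := by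
  intro N _ _ _ hN
  rw [eventually_torIsZero_iff] at hN
  have hA : HasFiniteProjDim A (A ⊗[R] N) := by
    refine h (A ⊗[R] N) inferInstance ((eventually_torIsZero_iff _ _).2 ?_)
    simpa only [torSuccVanishes_baseChange_iff, torSuccVanishes_faithfullyFlat_iff] using hN
  have hk := hA.eventually_torSuccVanishes (A ⊗[R] ResidueField R)
  simp only [torSuccVanishes_baseChange_iff, torSuccVanishes_faithfullyFlat_iff] at hk
  exact hasFiniteProjDim_of_torSuccVanishes hk

lemma IsPdTest.baseChange [IsLocalRing A] [IsNoetherianRing A]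
    (hm : maximalIdeal A = (maximalIdeal R).map (algebraMap R A))
    (hA : ∀ a : A, ∃ r : R, a - algebraMap R A r ∈ maximalIdeal A) (h : IsPdTest R M) :
    IsPdTest A (A ⊗[R] M) := by
  intro N _ _ _ hN
  rw [eventually_torIsZero_iff] at hN
  obtain ⟨F, ε, hF, hFF⟩ := exists_finite_free_resolution (A := A) N
  obtain ⟨K, hK, hK0, hd, hE, hT⟩ :=
    ModSeq.exists_koszul (maximalIdeal A).fg_of_isNoetherianRing F hFF
  obtain ⟨s, hs⟩ := hE ⟨0, fun n _ => hF.exact_succ n⟩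
  have := fun n => (hK n).2
  let : ∀ n, Module R (K.X n) := fun n => Module.compHom _ (algebraMap R A)
  have : ∀ n, IsScalarTower R A (K.X n) := fun n => .of_compHom R A _
  have hB := K.embedsInFlatWithFiniteCokernel_range hA hK hK0 hd s
  have hBM : ∃ n₀, ∀ n, n₀ ≤ n → TorSuccVanishes R (LinearMap.range (K.d s)) n M := by
    simpa only [K.eventuallyExact_tensor_iff _ s hs, torSuccVanishes_baseChange_iff] using
      (hT (A ⊗[R] M)).1 ((hF.eventuallyExact_tensor_iff hFF _).2 hN)
  have hBk := hB.eventually_torSuccVanishes h hBM (ResidueField R)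
  have hKk : (K.tensor (ResidueField A)).EventuallyExact := by
    simpa only [K.eventuallyExact_tensor_iff _ s hs,
      ← TorSuccVanishes.congr_left (tensorResidueFieldEquiv hm),
      torSuccVanishes_baseChange_iff] using hBk
  refine hasFiniteProjDim_of_torSuccVanishes ((hF.eventuallyExact_tensor_iff hFF _).1
    ((hT (ResidueField A)).2 (fun y hy t => ?_) hKk))
  rw [Algebra.smul_def, ResidueField.algebraMap_eq, (residue_eq_zero_iff y).2 hy, zero_mul]

end PdTest

/-- A finitely generated module `M` over a commutative Noetherian local ring `R` is a
pd-test module over `R` if and only if `R̂ ⊗_R M` is a pd-test module over the `m`-adic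
completion `R̂` of `R`. -/
theorem isPdTest_iff_completion (R : Type u) [CommRing R] [IsLocalRing R] [IsNoetherianRing R]
    (M : Type u) [AddCommGroup M] [Module R M] [Module.Finite R M] :
    IsPdTest R M ↔
      IsPdTest (AdicCompletion (maximalIdeal R) R)
        (AdicCompletion (maximalIdeal R) R ⊗[R] M) := by
  have hm := AdicCompletion.maximalIdeal_eq_map (R := R)
  refine ⟨IsPdTest.baseChange hm fun a => ?_, IsPdTest.of_baseChange⟩
  obtain ⟨x, hx⟩ := (AdicCompletion.residueField_map_bijective R).2 (residue _ a)
  obtain ⟨r, rfl⟩ := residue_surjective x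
  refine ⟨r, ?_⟩
  rw [← residue_eq_zero_iff, map_sub, ← hx, sub_eq_zero]
  rfl
end

section
/- Let φ : (R,m,k) → (S,n,l) be a local homomorphism of commutative Noetherian local rings such that S has finite flat dimension as an R-module (i.e., there exists an integer d such that Tor_i^R(S,N) = 0 for all i > d and all R-modules N). Let M be a finitely generated R-module with Tor_i^R(S,M) = 0 for all i ≥ 1. If S ⊗_R M is a pd-test module over S, then M is a pd-test module over R. -/
open CategoryTheory IsLocalRing

universe u

open scoped TensorProduct

section Resolution

variable {R : Type u} [CommRing R] {K F X : Type u} [AddCommGroup K] [Module R K]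
  [AddCommGroup F] [Module R F] [AddCommGroup X] [Module R X]

/-- The augmentation of a projective resolution, as a morphism in degree zero. -/
noncomputable def resolutionAug (P : ProjectiveResolution (ModuleCat.of R K)) :
    P.complex.X 0 ⟶ ModuleCat.of R K :=
  P.π.f 0

theorem d_comp_resolutionAug (P : ProjectiveResolution (ModuleCat.of R K)) :
    P.complex.d 1 0 ≫ resolutionAug P = 0 :=
  P.complex_d_comp_π_f_zero

theorem resolutionAug_surjective (P : ProjectiveResolution (ModuleCat.of R K)) :
    Function.Surjective (resolutionAug P).hom :=
  (ModuleCat.epi_iff_surjective (resolutionAug P)).mp (inferInstanceAs (Epi (P.π.f 0)))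

theorem d_resolutionAug_exact (P : ProjectiveResolution (ModuleCat.of R K)) :
    Function.Exact (P.complex.d 1 0).hom (resolutionAug P).hom :=
  (ShortComplex.ShortExact.moduleCat_exact_iff_function_exact
    (ShortComplex.mk _ _ (d_comp_resolutionAug P))).mp P.exact₀

theorem moduleCat_exactAt_succ_iff (C : ChainComplex (ModuleCat.{u} R) ℕ) (n : ℕ) :
    C.ExactAt (n + 1) ↔ Function.Exact (C.d (n + 2) (n + 1)).hom (C.d (n + 1) n).hom := by
  rw [HomologicalComplex.exactAt_iff' C (n + 2) (n + 1) n (by simp) (by simp)]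
  exact ShortComplex.ShortExact.moduleCat_exact_iff_function_exact _

theorem resolution_exact_succ (P : ProjectiveResolution (ModuleCat.of R K)) (n : ℕ) :
    Function.Exact (P.complex.d (n + 2) (n + 1)).hom (P.complex.d (n + 1) n).hom :=
  (moduleCat_exactAt_succ_iff _ n).mp (P.complex_exactAt_succ n)

/-- The complex obtained by splicing a projective resolution of `K` with a linear map `K → F`. -/
noncomputable def spliceComplex (f : K →ₗ[R] F) (P : ProjectiveResolution (ModuleCat.of R K)) :
    ChainComplex (ModuleCat.{u} R) ℕ :=
  ChainComplex.augment P.complex (X := ModuleCat.of R F)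
    (resolutionAug P ≫ ModuleCat.ofHom f) (by
      rw [← Category.assoc, d_comp_resolutionAug, Limits.zero_comp])

theorem exact_comp_of_injective {A B : Type u} [AddCommGroup A] [Module R A] [AddCommGroup B]
    [Module R B] {a : A →ₗ[R] B} {b : B →ₗ[R] K} {f : K →ₗ[R] F} (hab : Function.Exact a b)
    (hf : Function.Injective f) : Function.Exact a (f ∘ₗ b) := fun x => by
  rw [← hab x, LinearMap.comp_apply, map_eq_zero_iff f hf]

theorem exact_comp_of_surjective {A : Type u} [AddCommGroup A] [Module R A]
    {b : A →ₗ[R] K} {f : K →ₗ[R] F} {g : F →ₗ[R] X} (hb : Function.Surjective b)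
    (hfg : Function.Exact f g) : Function.Exact (f ∘ₗ b) g := fun x => by
  rw [hfg x, LinearMap.coe_comp, hb.range_comp]

theorem spliceComplex_exactAt (f : K →ₗ[R] F) (hf : Function.Injective f)
    (P : ProjectiveResolution (ModuleCat.of R K)) (n : ℕ) :
    (spliceComplex f P).ExactAt (n + 1) := by
  rw [moduleCat_exactAt_succ_iff]
  cases n with
  | zero => exact exact_comp_of_injective (d_resolutionAug_exact P) hf
  | succ n => exact resolution_exact_succ P n

/-- Splicing a projective resolution of `K` with a short exact sequence `0 → K → F → X → 0`
in which `F` is projective. -/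
noncomputable def spliceResolution [Module.Projective R F] (f : K →ₗ[R] F) (g : F →ₗ[R] X)
    (hf : Function.Injective f) (hfg : Function.Exact f g) (hg : Function.Surjective g)
    (P : ProjectiveResolution (ModuleCat.of R K)) :
    ProjectiveResolution (ModuleCat.of R X) where
  complex := spliceComplex f P
  projective
    | 0 => (IsProjective.iff_projective (R := R) F).mp inferInstance
    | n + 1 => P.projective n
  hasHomology := inferInstance
  π := (ChainComplex.toSingle₀Equiv _ _).symm ⟨ModuleCat.ofHom g, by
    ext x
    exact (hfg _).mpr ⟨_, rfl⟩⟩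
  quasiIso := ⟨fun n => by
    cases n
    · rw [ChainComplex.quasiIsoAt₀_iff, ShortComplex.quasiIso_iff_of_zeros' _ rfl rfl rfl]
      have hw : (spliceComplex f P).d 1 0 ≫ ModuleCat.ofHom g = 0 := by
        ext x
        exact (hfg _).mpr ⟨_, rfl⟩
      have he := (ShortComplex.ShortExact.moduleCat_exact_iff_function_exact
        (ShortComplex.mk (resolutionAug P ≫ ModuleCat.ofHom f) (ModuleCat.ofHom g) hw)).mpr
        (exact_comp_of_surjective (resolutionAug_surjective P) hfg)
      refine (ShortComplex.exact_and_epi_g_iff_of_iso ?_).2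
        ⟨he, (ModuleCat.epi_iff_surjective (ModuleCat.ofHom g)).mpr hg⟩
      exact ShortComplex.isoMk (Iso.refl _) (Iso.refl _) (Iso.refl _)
        ((Category.id_comp _).trans (Category.comp_id _).symm)
        ((Category.id_comp (ModuleCat.ofHom g)).trans
          ((ChainComplex.toSingle₀Equiv_symm_apply_f_zero (C := spliceComplex f P)
            (ModuleCat.ofHom g) hw).symm.trans (Category.comp_id _).symm))
    · rw [quasiIsoAt_iff_exactAt']
      · exact spliceComplex_exactAt f hf P _
      · exact ChainComplex.exactAt_succ_single_obj _ _⟩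

theorem torIsZero_iff_exactAt (A : Type u) [AddCommGroup A] [Module R A]
    (P : ProjectiveResolution (ModuleCat.of R X)) (i : ℕ) :
    TorIsZero R A X i ↔ ((((MonoidalCategory.tensoringLeft (ModuleCat.{u} R)).obj
      (ModuleCat.of R A)).mapHomologicalComplex _).obj P.complex).ExactAt i := by
  rw [HomologicalComplex.exactAt_iff_isZero_homology]
  exact (P.isoLeftDerivedObj _ i).isZero_iff

theorem torIsZero_succ_iff_exact (A : Type u) [AddCommGroup A] [Module R A]
    (P : ProjectiveResolution (ModuleCat.of R X)) (i : ℕ) :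
    TorIsZero R A X (i + 1) ↔ Function.Exact
      ((P.complex.d (i + 2) (i + 1)).hom.lTensor A) ((P.complex.d (i + 1) i).hom.lTensor A) := by
  rw [torIsZero_iff_exactAt A P, moduleCat_exactAt_succ_iff]
  rfl

theorem torIsZero_add_two_iff [Module.Projective R F] {f : K →ₗ[R] F} {g : F →ₗ[R] X}
    (hf : Function.Injective f) (hfg : Function.Exact f g) (hg : Function.Surjective g)
    (A : Type u) [AddCommGroup A] [Module R A] (i : ℕ) :
    TorIsZero R A X (i + 2) ↔ TorIsZero R A K (i + 1) := by
  let P := projectiveResolution (ModuleCat.of R K)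
  rw [torIsZero_succ_iff_exact A (spliceResolution f g hf hfg hg P),
    torIsZero_succ_iff_exact A P]
  rfl

theorem torIsZero_one_iff [Module.Projective R F] {f : K →ₗ[R] F} {g : F →ₗ[R] X}
    (hf : Function.Injective f) (hfg : Function.Exact f g) (hg : Function.Surjective g)
    (A : Type u) [AddCommGroup A] [Module R A] :
    TorIsZero R A X 1 ↔ Function.Injective (f.lTensor A) := by
  let P := projectiveResolution (ModuleCat.of R K)
  rw [torIsZero_succ_iff_exact A (spliceResolution f g hf hfg hg P)]
  have he := lTensor_exact A (d_resolutionAug_exact P) (resolutionAug_surjective P)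
  have hs := LinearMap.lTensor_surjective A (resolutionAug_surjective P)
  change Function.Exact ((P.complex.d 1 0).hom.lTensor A)
    ((f ∘ₗ (resolutionAug P).hom).lTensor A) ↔ _
  rw [LinearMap.lTensor_comp]
  refine ⟨fun h => ?_, fun h => exact_comp_of_injective he h⟩
  rw [injective_iff_map_eq_zero]
  intro y hy
  obtain ⟨x, rfl⟩ := hs y
  exact (he x).mpr ((h x).mp hy)

theorem hasFiniteProjDim_of_exact [Module.Projective R F] {f : K →ₗ[R] F} {g : F →ₗ[R] X}
    (hf : Function.Injective f) (hfg : Function.Exact f g) (hg : Function.Surjective g)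
    (h : HasFiniteProjDim R K) : HasFiniteProjDim R X := by
  obtain ⟨n, P, hP⟩ := h
  refine ⟨n + 1, spliceResolution f g hf hfg hg P, fun i hi => ?_⟩
  obtain ⟨j, rfl⟩ : ∃ j, i = j + 1 := ⟨i - 1, by omega⟩
  exact hP j (by omega)

theorem hasFiniteProjDim_of_subsingleton [Subsingleton X] : HasFiniteProjDim R X := by
  have h0 : Limits.IsZero (ModuleCat.of R X) := ModuleCat.isZero_of_subsingleton _
  have := h0.projective
  refine ⟨0, ProjectiveResolution.self _, fun i hi => ?_⟩
  exact HomologicalComplex.isZero_single_obj_X _ _ _ _ (by omega)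

theorem HasFiniteProjDim.exists_torIsZero (h : HasFiniteProjDim R X) :
    ∃ n : ℕ, ∀ i, n < i → ∀ (A : Type u) [AddCommGroup A] [Module R A], TorIsZero R A X i := by
  obtain ⟨n, P, hP⟩ := h
  refine ⟨n, fun i hi A _ _ => ?_⟩
  rw [torIsZero_iff_exactAt A P]
  exact ShortComplex.exact_of_isZero_X₂ _ (Functor.map_isZero
    ((MonoidalCategory.tensoringLeft (ModuleCat.{u} R)).obj (ModuleCat.of R A)) (hP i hi))

end Resolution

section Vanishing

variable {R : Type u} [CommRing R]

theorem exists_free_cover (R : Type u) [CommRing R] (X : Type u) [AddCommGroup X] [Module R X] :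
    ∃ (F : Type u) (_ : AddCommGroup F) (_ : Module R F) (g : F →ₗ[R] X),
      Module.Projective R F ∧ Function.Surjective g :=
  ⟨X →₀ R, inferInstance, inferInstance, Finsupp.linearCombination R id, inferInstance,
    Finsupp.linearCombination_id_surjective R X⟩

/-- If `Tor_1(A, X) = 0`, tensoring with `A` keeps every short exact sequence ending in `X`
exact. -/
theorem lTensor_injective_of_torIsZero_one {L G X A : Type u} [AddCommGroup L] [Module R L]
    [AddCommGroup G] [Module R G] [AddCommGroup X] [Module R X] [AddCommGroup A] [Module R A]
    {i : L →ₗ[R] G} {p : G →ₗ[R] X} (hi : Function.Injective i) (hip : Function.Exact i p)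
    (hp : Function.Surjective p) (h : TorIsZero R A X 1) :
    Function.Injective (i.lTensor A) := by
  obtain ⟨F, _, _, g, _, hg⟩ := exists_free_cover R X
  rw [torIsZero_one_iff g.ker.injective_subtype g.exact_subtype_ker_map hg A] at h
  obtain ⟨s, hs⟩ := Module.projective_lifting_property p g hp
  have hs' : ∀ x, p (s x) = g x := fun x => LinearMap.congr_fun hs x
  -- `0 → ker g → L × F → G → 0` is exact
  have hk : ∀ x : g.ker, ∃ y, i y = s x := fun x => (hip _).mp (by rw [hs', x.2])
  let e := LinearEquiv.ofInjective i hi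
  let t : g.ker →ₗ[R] L := e.symm.toLinearMap ∘ₗ
    ((s ∘ₗ g.ker.subtype).codRestrict i.range fun x => hk x)
  have ht : ∀ x, i (t x) = s x := fun x =>
    congrArg Subtype.val (e.apply_symm_apply ⟨s x, hk x⟩)
  let a : g.ker →ₗ[R] L × F := (-t).prod g.ker.subtype
  let b : L × F →ₗ[R] G := i.coprod s
  have hab : Function.Exact a b := by
    rintro ⟨l, f⟩
    constructor
    · intro hlf
      have hlf' : i l + s f = 0 := by simpa [b] using hlf
      have hf : g f = 0 := by
        rw [← hs', eq_neg_of_add_eq_zero_right hlf', map_neg, hip.apply_apply_eq_zero, neg_zero]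
      refine ⟨⟨f, hf⟩, Prod.ext (hi ?_) rfl⟩
      simp [a, ht, eq_neg_of_add_eq_zero_right hlf']
    · rintro ⟨x, hx⟩
      rw [← hx]
      simp [a, b, ht]
  have hb : Function.Surjective b := by
    intro y
    obtain ⟨f, hf⟩ := hg (p y)
    obtain ⟨l, hl⟩ := (hip (y - s f)).mp (by rw [map_sub, hs', hf, sub_self])
    exact ⟨(l, f), by simp [b, hl]⟩
  have hT := lTensor_exact A hab hb
  rw [injective_iff_map_eq_zero]
  intro y hy
  obtain ⟨k, hk⟩ := (hT ((LinearMap.inl R L F).lTensor A y)).mp (by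
    rw [← LinearMap.lTensor_comp_apply, LinearMap.coprod_inl, hy])
  have hk0 : k = 0 := by
    refine (injective_iff_map_eq_zero _).mp h k ?_
    have := congrArg ((LinearMap.snd R L F).lTensor A) hk
    rwa [← LinearMap.lTensor_comp_apply, ← LinearMap.lTensor_comp_apply, LinearMap.snd_prod,
      LinearMap.snd_comp_inl, LinearMap.lTensor_zero, LinearMap.zero_apply] at this
  have := congrArg ((LinearMap.fst R L F).lTensor A) hk
  rwa [hk0, map_zero, map_zero, ← LinearMap.lTensor_comp_apply, LinearMap.fst_comp_inl,
    LinearMap.lTensor_id, LinearMap.id_apply, eq_comm] at this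

/-- Tensoring with a projective module preserves vanishing of `Tor`. -/
theorem torIsZero_tensor_projective {A F : Type u} [AddCommGroup A] [Module R A]
    [AddCommGroup F] [Module R F] [Module.Projective R F] (n : ℕ) :
    ∀ (X : Type u) [AddCommGroup X] [Module R X],
      TorIsZero R A X (n + 1) → TorIsZero R A (X ⊗[R] F) (n + 1) := by
  induction n with
  | zero =>
    intro X _ _ h
    obtain ⟨G, _, _, g, _, hg⟩ := exists_free_cover R X
    rw [torIsZero_one_iff g.ker.injective_subtype g.exact_subtype_ker_map hg A] at h
    rw [torIsZero_one_iff (Module.Flat.rTensor_preserves_injective_linearMap (M := F) _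
      g.ker.injective_subtype) (rTensor_exact F g.exact_subtype_ker_map hg)
      (LinearMap.rTensor_surjective F hg) A]
    have h' := Module.Flat.rTensor_preserves_injective_linearMap (M := F) _ h
    have he : (g.ker.subtype.rTensor F).lTensor A ∘ₗ (TensorProduct.assoc R A g.ker F).toLinearMap
        = (TensorProduct.assoc R A G F).toLinearMap ∘ₗ (g.ker.subtype.lTensor A).rTensor F :=
      TensorProduct.ext_threefold fun _ _ _ => rfl
    have h2 := (TensorProduct.assoc R A G F).injective.comp h'
    rw [← LinearEquiv.coe_toLinearMap, ← LinearMap.coe_comp, ← he, LinearMap.coe_comp] at h2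
    exact (Function.Injective.of_comp_iff' _ (TensorProduct.assoc R A g.ker F).bijective).mp h2
  | succ n ih =>
    intro X _ _ h
    obtain ⟨G, _, _, g, _, hg⟩ := exists_free_cover R X
    rw [torIsZero_add_two_iff g.ker.injective_subtype g.exact_subtype_ker_map hg A] at h
    rw [torIsZero_add_two_iff (Module.Flat.rTensor_preserves_injective_linearMap (M := F) _
      g.ker.injective_subtype) (rTensor_exact F g.exact_subtype_ker_map hg)
      (LinearMap.rTensor_surjective F hg) A]
    exact ih _ h

/-- The part `Tor_{n+2}(A, X₃) → Tor_{n+1}(A, X₁) → Tor_{n+1}(A, X₂)` of the long exact sequence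
of `Tor`, in terms of vanishing. -/
theorem torIsZero_of_exact {A : Type u} [AddCommGroup A] [Module R A] (n : ℕ) :
    ∀ {X₁ X₂ X₃ : Type u} [AddCommGroup X₁] [Module R X₁] [AddCommGroup X₂] [Module R X₂]
      [AddCommGroup X₃] [Module R X₃] {i : X₁ →ₗ[R] X₂} {p : X₂ →ₗ[R] X₃},
      Function.Injective i → Function.Exact i p → Function.Surjective p →
      TorIsZero R A X₃ (n + 2) → TorIsZero R A X₂ (n + 1) → TorIsZero R A X₁ (n + 1) := by
  induction n using Nat.strongRecOn with
  | _ n ih =>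
  intro X₁ X₂ X₃ _ _ _ _ _ _ i p hi hip hp h₃ h₂
  obtain ⟨F₁, _, _, g₁, _, hg₁⟩ := exists_free_cover R X₁
  obtain ⟨F₃, _, _, g₃, _, hg₃⟩ := exists_free_cover R X₃
  obtain ⟨s, hs⟩ := Module.projective_lifting_property p g₃ hp
  have hs' : ∀ x, p (s x) = g₃ x := fun x => LinearMap.congr_fun hs x
  let g₂ : F₁ × F₃ →ₗ[R] X₂ := (i ∘ₗ g₁).coprod s
  have hg₂ : Function.Surjective g₂ := by
    intro y
    obtain ⟨b, hb⟩ := hg₃ (p y)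
    obtain ⟨x, hx⟩ := (hip (y - s b)).mp (by rw [map_sub, hs', hb, sub_self])
    obtain ⟨a, rfl⟩ := hg₁ x
    exact ⟨(a, b), by simp [g₂, hx]⟩
  have hp₂ : ∀ a b, p (g₂ (a, b)) = g₃ b := fun a b => by
    simp [g₂, hs', hip.apply_apply_eq_zero]
  let j : g₁.ker →ₗ[R] g₂.ker :=
    (LinearMap.inl R F₁ F₃).restrict fun x hx => by
      simpa [g₂] using (by rw [LinearMap.mem_ker.mp hx, map_zero] : i (g₁ x) = 0)
  let q : g₂.ker →ₗ[R] g₃.ker :=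
    (LinearMap.snd R F₁ F₃).restrict fun x hx => by
      rw [LinearMap.mem_ker, LinearMap.snd_apply, ← hp₂ x.1 x.2, LinearMap.mem_ker.mp hx, map_zero]
  have hj : Function.Injective j := fun x y hxy =>
    Subtype.ext (congrArg (fun z => z.1.1) hxy)
  have hjq : Function.Exact j q := by
    rintro ⟨⟨a, b⟩, hab⟩
    constructor
    · intro h
      obtain rfl : b = 0 := congrArg Subtype.val h
      refine ⟨⟨a, hi ?_⟩, rfl⟩
      simpa [g₂] using hab
    · rintro ⟨x, hx⟩
      rw [← hx]
      rfl
  have hq : Function.Surjective q := by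
    rintro ⟨b, hb⟩
    obtain ⟨x, hx⟩ := (hip (s b)).mp (by rw [hs', hb])
    obtain ⟨a, rfl⟩ := hg₁ x
    exact ⟨⟨(-a, b), by simp [g₂, hx]⟩, rfl⟩
  rw [torIsZero_add_two_iff g₃.ker.injective_subtype g₃.exact_subtype_ker_map hg₃ A] at h₃
  cases n with
  | zero =>
    rw [torIsZero_one_iff g₂.ker.injective_subtype g₂.exact_subtype_ker_map hg₂ A] at h₂
    rw [torIsZero_one_iff g₁.ker.injective_subtype g₁.exact_subtype_ker_map hg₁ A]
    have h := h₂.comp (lTensor_injective_of_torIsZero_one hj hjq hq h₃)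
    rw [← LinearMap.coe_comp, ← LinearMap.lTensor_comp] at h
    have he : g₂.ker.subtype ∘ₗ j = LinearMap.inl R F₁ F₃ ∘ₗ g₁.ker.subtype := rfl
    rw [he, LinearMap.lTensor_comp, LinearMap.coe_comp] at h
    exact h.of_comp
  | succ n =>
    rw [torIsZero_add_two_iff g₂.ker.injective_subtype g₂.exact_subtype_ker_map hg₂ A] at h₂
    rw [torIsZero_add_two_iff g₁.ker.injective_subtype g₁.exact_subtype_ker_map hg₁ A]
    exact ih n n.lt_succ_self hj hjq hq h₃ h₂

end Vanishing

section LocalRing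

/-- A finitely generated module over a local ring is a quotient of a finite free module by a
submodule of the maximal ideal times the free module. -/
theorem exists_minimal_cover (R X : Type u) [CommRing R] [IsLocalRing R] [AddCommGroup X]
    [Module R X] [Module.Finite R X] :
    ∃ (n : ℕ) (g : (Fin n → R) →ₗ[R] X), Function.Surjective g ∧
      g.ker ≤ maximalIdeal R • (⊤ : Submodule R (Fin n → R)) := by
  let b := Module.finBasis (ResidueField R) (ResidueField R ⊗[R] X)
  have hsurj : Function.Surjective (TensorProduct.mk R (ResidueField R) X 1) :=
    TensorProduct.mk_surjective R X (ResidueField R) Ideal.Quotient.mk_surjective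
  choose v hv using fun i => hsurj (b i)
  refine ⟨_, Fintype.linearCombination R v, ?_, ?_⟩
  · rw [← LinearMap.range_eq_top, Fintype.range_linearCombination]
    exact span_eq_top_of_tmul_eq_basis v b hv
  · intro x hx
    have h0 : ∑ i, residue R (x i) • b i = 0 := by
      have := congrArg (TensorProduct.mk R (ResidueField R) X 1) (LinearMap.mem_ker.mp hx)
      rw [Fintype.linearCombination_apply, map_sum, map_zero] at this
      rw [← this]
      refine Finset.sum_congr rfl fun i _ => ?_
      rw [map_smul, hv]
      rfl
    have hx' : ∀ i, x i ∈ maximalIdeal R := fun i =>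
      (residue_eq_zero_iff _).mp (Fintype.linearIndependent_iff.mp b.linearIndependent _ h0 i)
    rw [pi_eq_sum_univ' x]
    exact Submodule.sum_mem _ fun i _ => Submodule.smul_mem_smul (hx' i) trivial

variable {R S : Type u} [CommRing R] [CommRing S] [IsLocalRing R] [IsLocalRing S] [Algebra R S]
  [IsLocalHom (algebraMap R S)]

theorem tmul_tmul_eq_zero_of_mem_smul_top {F : Type u} [AddCommGroup F] [Module R F] {x : F}
    (hx : x ∈ maximalIdeal R • (⊤ : Submodule R F)) (c : ResidueField S) (s : S) :
    c ⊗ₜ[S] (s ⊗ₜ[R] x) = 0 := by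
  induction hx using Submodule.smul_induction_on' with
  | smul r hr y _ =>
    have hr' : residue S (algebraMap R S r) = 0 :=
      (residue_eq_zero_iff _).mpr ((mem_maximalIdeal _).mpr fun hu =>
        (mem_maximalIdeal _).mp hr (isUnit_of_map_unit (algebraMap R S) r hu))
    rw [← TensorProduct.smul_tmul, Algebra.smul_def, ← smul_eq_mul, ← TensorProduct.smul_tmul',
      ← TensorProduct.smul_tmul, Algebra.smul_def, ResidueField.algebraMap_eq, hr', zero_mul,
      TensorProduct.zero_tmul]
  | add y _ z _ hy hz => rw [TensorProduct.tmul_add, TensorProduct.tmul_add, hy, hz, add_zero]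

/-- Nakayama along a local homomorphism. -/
theorem subsingleton_of_subsingleton_residueField_tensor_baseChange {K : Type u}
    [AddCommGroup K] [Module R K] [Module.Finite R K]
    [Subsingleton (ResidueField S ⊗[S] (S ⊗[R] K))] : Subsingleton K := by
  have h1 : Subsingleton (ResidueField S ⊗[R] K) :=
    (TensorProduct.AlgebraTensorModule.cancelBaseChange R S S (ResidueField S)
      K).symm.toEquiv.subsingleton
  have h2 : Subsingleton (ResidueField S ⊗[ResidueField R] (ResidueField R ⊗[R] K)) :=
    (TensorProduct.AlgebraTensorModule.cancelBaseChange R (ResidueField R) (ResidueField R)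
      (ResidueField S) K).toEquiv.subsingleton
  exact (IsLocalRing.subsingleton_tensorProduct (R := R)).mp
    (Module.FaithfullyFlat.lTensor_reflects_triviality (ResidueField R) (ResidueField S) _)

end LocalRing

section BaseChange

variable {R S : Type u} [CommRing R] [CommRing S] [Algebra R S]

/-- Base change along `R → S` of a short exact sequence ending in a module with
`Tor_1(S, X) = 0`. -/
theorem baseChange_injective {L G X : Type u} [AddCommGroup L] [Module R L]
    [AddCommGroup G] [Module R G] [AddCommGroup X] [Module R X]
    {i : L →ₗ[R] G} {p : G →ₗ[R] X} (hi : Function.Injective i) (hip : Function.Exact i p)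
    (hp : Function.Surjective p) (h : TorIsZero R S X 1) :
    Function.Injective (i.baseChange S) :=
  lTensor_injective_of_torIsZero_one hi hip hp h

theorem baseChange_exact {L G X : Type u} [AddCommGroup L] [Module R L]
    [AddCommGroup G] [Module R G] [AddCommGroup X] [Module R X]
    {i : L →ₗ[R] G} {p : G →ₗ[R] X} (hip : Function.Exact i p) (hp : Function.Surjective p) :
    Function.Exact (i.baseChange S) (p.baseChange S) :=
  lTensor_exact S hip hp

theorem baseChange_surjective {G X : Type u} [AddCommGroup G] [Module R G] [AddCommGroup X]
    [Module R X] {p : G →ₗ[R] X} (hp : Function.Surjective p) :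
    Function.Surjective (p.baseChange S) :=
  LinearMap.lTensor_surjective S hp

end BaseChange

section Descent

variable {R S : Type u} [CommRing R] [CommRing S] [Algebra R S]

/-- If the `S`-module `S ⊗ N` computes the derived base change of `N`, bounded vanishing of
`Tor^S(l, S ⊗ N)` bounds the projective dimension of `N` over `R`. -/
theorem hasFiniteProjDim_of_torIsZero_residueField [IsLocalRing R] [IsNoetherianRing R]
    [IsLocalRing S] [IsLocalHom (algebraMap R S)] (n : ℕ) :
    ∀ (N : Type u) [AddCommGroup N] [Module R N] [Module.Finite R N],
      (∀ i, TorIsZero R S N (i + 1)) →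
      (∀ i, n ≤ i → TorIsZero S (ResidueField S) (S ⊗[R] N) (i + 1)) →
      HasFiniteProjDim R N := by
  induction n with
  | zero =>
    intro N _ _ _ hS hl
    obtain ⟨m, g, hg, hm⟩ := exists_minimal_cover R N
    have hi := g.ker.injective_subtype
    have he := g.exact_subtype_ker_map
    have h1 := (torIsZero_one_iff (baseChange_injective hi he hg (hS 0)) (baseChange_exact he hg)
      (baseChange_surjective hg) (ResidueField S)).mp (hl 0 le_rfl)
    have h0 : (g.ker.subtype.baseChange S).lTensor (ResidueField S) = 0 := by
      refine TensorProduct.ext' fun c y => ?_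
      induction y with
      | zero => simp
      | add y z hy hz => rw [TensorProduct.tmul_add, map_add, map_add, hy, hz]
      | tmul s x => exact tmul_tmul_eq_zero_of_mem_smul_top (hm x.2) c s
    have : Subsingleton (ResidueField S ⊗[S] (S ⊗[R] g.ker)) :=
      ⟨fun x y => h1 (by rw [h0]; rfl)⟩
    have := subsingleton_of_subsingleton_residueField_tensor_baseChange (R := R) (S := S)
      (K := g.ker)
    exact hasFiniteProjDim_of_exact hi he hg hasFiniteProjDim_of_subsingleton
  | succ n ih =>
    intro N _ _ _ hS hl
    obtain ⟨m, g, hg⟩ := Module.Finite.exists_fin' R N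
    have hi := g.ker.injective_subtype
    have he := g.exact_subtype_ker_map
    refine hasFiniteProjDim_of_exact hi he hg (ih _
      (fun i => (torIsZero_add_two_iff hi he hg S i).mp (hS _)) fun i hni => ?_)
    exact (torIsZero_add_two_iff (baseChange_injective hi he hg (hS 0)) (baseChange_exact he hg)
      (baseChange_surjective hg) (ResidueField S) i).mp (hl _ (by omega))

/-- `Tor^S(S ⊗ M, S ⊗ N)` vanishes in positive degrees when `Tor^R(M, N)`, `Tor^R(S, M)`,
`Tor^R(S, N)` and `Tor^R(S, M ⊗ N)` do. -/
theorem torIsZero_baseChange (M : Type u) [AddCommGroup M] [Module R M]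
    (hM : ∀ i, TorIsZero R S M (i + 1)) (n : ℕ) :
    ∀ (N : Type u) [AddCommGroup N] [Module R N],
      (∀ i, TorIsZero R M N (i + 1)) → (∀ i, TorIsZero R S N (i + 1)) →
      (∀ i, TorIsZero R S (M ⊗[R] N) (i + 1)) →
      TorIsZero S (S ⊗[R] M) (S ⊗[R] N) (n + 1) := by
  induction n with
  | zero =>
    intro N _ _ hMN hS hSMN
    obtain ⟨F, _, _, g, _, hg⟩ := exists_free_cover R N
    have hi := g.ker.injective_subtype
    have he := g.exact_subtype_ker_map
    rw [torIsZero_one_iff (baseChange_injective hi he hg (hS 0)) (baseChange_exact he hg)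
      (baseChange_surjective hg)]
    have h1 := baseChange_injective (lTensor_injective_of_torIsZero_one hi he hg (hMN 0))
      (lTensor_exact M he hg) (LinearMap.lTensor_surjective M hg) (hSMN 0)
    let eK := TensorProduct.AlgebraTensorModule.distribBaseChange R S M g.ker
    let eF := TensorProduct.AlgebraTensorModule.distribBaseChange R S M F
    have hc : (g.ker.subtype.baseChange S).lTensor (S ⊗[R] M) ∘ₗ eK.toLinearMap =
        eF.toLinearMap ∘ₗ (g.ker.subtype.lTensor M).baseChange S := by
      ext
      rfl
    have h2 := eF.injective.comp h1
    rw [← LinearEquiv.coe_toLinearMap, ← LinearMap.coe_comp, ← hc, LinearMap.coe_comp] at h2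
    exact (Function.Injective.of_comp_iff' _ eK.bijective).mp h2
  | succ n ih =>
    intro N _ _ hMN hS hSMN
    obtain ⟨F, _, _, g, _, hg⟩ := exists_free_cover R N
    have hi := g.ker.injective_subtype
    have he := g.exact_subtype_ker_map
    rw [torIsZero_add_two_iff (baseChange_injective hi he hg (hS 0)) (baseChange_exact he hg)
      (baseChange_surjective hg)]
    refine ih _ (fun i => (torIsZero_add_two_iff hi he hg M i).mp (hMN _))
      (fun i => (torIsZero_add_two_iff hi he hg S i).mp (hS _)) fun i => ?_
    exact torIsZero_of_exact i (lTensor_injective_of_torIsZero_one hi he hg (hMN 0))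
      (lTensor_exact M he hg) (LinearMap.lTensor_surjective M hg) (hSMN _)
      (torIsZero_tensor_projective i M (hM i))

/-- The case of the descent theorem in which all `Tor^R(M, N)` and `Tor^R(S, N)` vanish in
positive degrees. -/
theorem hasFiniteProjDim_of_isPdTest_baseChange [IsLocalRing R] [IsNoetherianRing R]
    [IsLocalRing S] [IsLocalHom (algebraMap R S)] (M : Type u) [AddCommGroup M] [Module R M]
    (hM : ∀ i, TorIsZero R S M (i + 1)) (h : IsPdTest S (S ⊗[R] M)) (d : ℕ) :
    ∀ (N : Type u) [AddCommGroup N] [Module R N] [Module.Finite R N],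
      (∀ i, TorIsZero R M N (i + 1)) → (∀ i, TorIsZero R S N (i + 1)) →
      (∀ i, d ≤ i → TorIsZero R S (M ⊗[R] N) (i + 1)) → HasFiniteProjDim R N := by
  induction d with
  | zero =>
    intro N _ _ _ hMN hS hSMN
    have ht : ∀ i, 0 < i → TorIsZero S (S ⊗[R] M) (S ⊗[R] N) i := fun i hi => by
      obtain ⟨j, rfl⟩ : ∃ j, i = j + 1 := ⟨i - 1, by omega⟩
      exact torIsZero_baseChange M hM j N hMN hS fun i => hSMN i i.zero_le
    obtain ⟨n, hn⟩ := (h (S ⊗[R] N) inferInstance ⟨0, ht⟩).exists_torIsZero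
    exact hasFiniteProjDim_of_torIsZero_residueField n N hS fun i hi => hn _ (by omega) _
  | succ d ih =>
    intro N _ _ _ hMN hS hSMN
    obtain ⟨m, g, hg⟩ := Module.Finite.exists_fin' R N
    have hi := g.ker.injective_subtype
    have he := g.exact_subtype_ker_map
    refine hasFiniteProjDim_of_exact hi he hg (ih _
      (fun i => (torIsZero_add_two_iff hi he hg M i).mp (hMN _))
      (fun i => (torIsZero_add_two_iff hi he hg S i).mp (hS _)) fun i hdi => ?_)
    exact torIsZero_of_exact i (lTensor_injective_of_torIsZero_one hi he hg (hMN 0))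
      (lTensor_exact M he hg) (LinearMap.lTensor_surjective M hg) (hSMN _ (by omega))
      (torIsZero_tensor_projective i M (hM i))

/-- Finiteness of projective dimension may be checked after passing to high syzygies. -/
theorem hasFiniteProjDim_of_torIsZero_of_le [IsNoetherianRing R]
    (A B : Type u) [AddCommGroup A] [Module R A] [AddCommGroup B] [Module R B]
    (h : ∀ (N : Type u) [AddCommGroup N] [Module R N] [Module.Finite R N],
      (∀ i, TorIsZero R A N (i + 1)) → (∀ i, TorIsZero R B N (i + 1)) → HasFiniteProjDim R N)
    (t : ℕ) :
    ∀ (N : Type u) [AddCommGroup N] [Module R N] [Module.Finite R N],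
      (∀ i, t ≤ i → TorIsZero R A N (i + 1)) → (∀ i, t ≤ i → TorIsZero R B N (i + 1)) →
      HasFiniteProjDim R N := by
  induction t with
  | zero => exact fun N _ _ _ hA hB => h N (fun i => hA i i.zero_le) fun i => hB i i.zero_le
  | succ t ih =>
    intro N _ _ _ hA hB
    obtain ⟨m, g, hg⟩ := Module.Finite.exists_fin' R N
    have hi := g.ker.injective_subtype
    have he := g.exact_subtype_ker_map
    exact hasFiniteProjDim_of_exact hi he hg (ih _
      (fun i hti => (torIsZero_add_two_iff hi he hg A i).mp (hA _ (by omega)))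
      fun i hti => (torIsZero_add_two_iff hi he hg B i).mp (hB _ (by omega)))

end Descent

/-- Let `φ : (R,m,k) → (S,n,l)` be a local homomorphism of commutative Noetherian local
rings such that `S` has finite flat dimension over `R`, and let `M` be a finitely
generated `R`-module with `Tor_i^R(S, M) = 0` for all `i ≥ 1`.  If `S ⊗_R M` is a
pd-test module over `S`, then `M` is a pd-test module over `R`. -/
theorem isPdTest_of_baseChange_isPdTest_of_finite_flat_dimension (R S : Type u)
    [CommRing R] [IsLocalRing R] [IsNoetherianRing R]
    [CommRing S] [IsLocalRing S] [IsNoetherianRing S]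
    [Algebra R S] [IsLocalHom (algebraMap R S)]
    (hfd : ∃ d : ℕ, ∀ i, d < i → ∀ (N : Type u) [AddCommGroup N] [Module R N],
      TorIsZero R S N i)
    (M : Type u) [AddCommGroup M] [Module R M] [Module.Finite R M]
    (htor : ∀ i, 1 ≤ i → TorIsZero R S M i)
    (h : IsPdTest S (S ⊗[R] M)) :
    IsPdTest R M := by
  obtain ⟨d, hd⟩ := hfd
  intro N _ _ _ hN
  obtain ⟨n, hn⟩ := hN
  refine hasFiniteProjDim_of_torIsZero_of_le M S (fun N' _ _ _ hMN hSN => ?_) (max n d) N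
    (fun i hi => hn _ (by omega)) fun i hi => hd _ (by omega) N
  exact hasFiniteProjDim_of_isPdTest_baseChange M (fun i => htor _ (by omega)) h d N' hMN hSN
    fun i hi => hd _ (by omega) _
end
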